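/- arXiv:2005.02232 — 2 statements merged into one kernel-verified Lean document; each statement's English description precedes it below -/
import Mathlib

section
/- Let T ∈ ℕ* and C > 0. Under the same assumptions as for the stability of the value function — B₂ := (𝒫₂(ℝ^{2d}))^T × 𝒫₂(ℝ^d) with d₁ the sum of componentwise Kantorovich–Rubinstein distances; M_t nonempty subsets of 𝒫₂^C(ℝ^d); F and P such that for all t and b₁,b₂ ∈ B₂: F(t,·,b₁) convex with −C ≤ F(t,x,b₁) ≤ C(1+|x|²), ‖F(t,·,b₁)−F(t,·,b₂)‖_{𝒢,2} ≤ C·d₁(b₁,b₂), |P(t,b₁)−P(t,b₂)| ≤ C·d₁(b₁,b₂), |P(t,b₁)| ≤ C — let, for b ∈ B₂, (u*(·,·,b), ū*(·,·,b)) be the unique at-most-quadratic-growth solution of the backward dynamic programming recursion with data (F(·,·,b), P(·,b), (M_t)), and let α*_t(x,b) := prox_{ū*(t+1,·,b)}(x − P(t,b)) − x be the associated optimal feedback. Then there exists a constant C' > 0 depending only on C and T such that for all t ∈ {0,…,T−1} and all b₁, b₂ ∈ B₂: ‖α*_t(·,b₁) − α*_t(·,b₂)‖_{𝒢,1} ≤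 C'·( d₁(b₁,b₂)^{1/2} + d₁(b₁,b₂) ). -/
open MeasureTheory ENNReal
open scoped RealInnerProductSpace

/-- `ℝ^d` with the Euclidean norm. -/
abbrev Euc (d : ℕ) := EuclideanSpace ℝ (Fin d)

/-- `ℝ^{2d} = ℝ^d × ℝ^d` with the Euclidean (L²) product norm. -/
abbrev Euc2 (d : ℕ) := WithLp 2 (Euc d × Euc d)

noncomputable instance (d : ℕ) : MeasurableSpace (Euc2 d) := borel _
instance (d : ℕ) : BorelSpace (Euc2 d) := ⟨rfl⟩

/-- The Kantorovich–Rubinstein distance: the supremum of `∫ φ dμ − ∫ φ dν` over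
1-Lipschitz functions `φ`. -/
noncomputable def d1 {X : Type*} [MeasurableSpace X] [NormedAddCommGroup X]
    (μ ν : Measure X) : ℝ :=
  sSup {r : ℝ | ∃ φ : X → ℝ, LipschitzWith 1 φ ∧ r = ∫ x, φ x ∂μ - ∫ x, φ x ∂ν}

/-- The set of beliefs `B₂ = (𝒫(ℝ^{2d}))^T × 𝒫(ℝ^d)` (as raw measures, possibly not of
finite second moment: membership in `𝒫₂` is the predicate `MemB2`). -/
def B2 (T d : ℕ) := (Fin T → Measure (Euc2 d)) × Measure (Euc d)

/-- `b ∈ (𝒫₂(ℝ^{2d}))^T × 𝒫₂(ℝ^d)`: all components are Borel probability measures with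
finite second moments. -/
def MemB2 {T d : ℕ} (b : B2 T d) : Prop :=
  (∀ t : Fin T, IsProbabilityMeasure (b.1 t) ∧
    ∫⁻ z, (‖z‖₊ : ℝ≥0∞) ^ (2 : ℕ) ∂(b.1 t) < ⊤) ∧
  IsProbabilityMeasure b.2 ∧ ∫⁻ x, (‖x‖₊ : ℝ≥0∞) ^ (2 : ℕ) ∂b.2 < ⊤

/-- The distance on beliefs: the sum of the componentwise Kantorovich–Rubinstein
distances. -/
noncomputable def d1B {T d : ℕ} (b b' : B2 T d) : ℝ :=
  (∑ t : Fin T, d1 (b.1 t) (b'.1 t)) + d1 b.2 b'.2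

/-- `(u, ū)` is an at-most-quadratic-growth solution of the backward dynamic
programming recursion with data `(Fb, Pb, M)`. -/
def IsDPRecursion (T : ℕ) {d : ℕ} (M : ℕ → Set (Measure (Euc d)))
    (Fb : ℕ → Euc d → ℝ) (Pb : ℕ → Euc d) (u ubar : ℕ → Euc d → ℝ) : Prop :=
  (∀ t ≤ T, ∃ K : ℝ, ∀ x, |u t x| ≤ K * (1 + ‖x‖ ^ 2)) ∧
  (∀ t, 1 ≤ t → t ≤ T → ∃ K : ℝ, ∀ x, |ubar t x| ≤ K * (1 + ‖x‖ ^ 2)) ∧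
  (∀ x, u T x = Fb T x) ∧
  (∀ t < T, ∀ x, ubar (t + 1) x =
    ⨆ ξ : M t, ∫ y, u (t + 1) (x + y) ∂(ξ : Measure (Euc d))) ∧
  (∀ t < T, ∀ x, u t x =
    ⨅ a : Euc d, (1 / 2) * ‖a‖ ^ 2 + ⟪a, Pb t⟫ + Fb t x + ubar (t + 1) (x + a))


/-- `q` is the proximal point of `w` at `z`, i.e. `q` minimizes
`y ↦ ½|z−y|² + w(y)` over `ℝ^d`. -/
def IsProx {d : ℕ} (w : Euc d → ℝ) (z q : Euc d) : Prop :=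
  ∀ y, (1 / 2) * ‖z - q‖ ^ 2 + w q ≤ (1 / 2) * ‖z - y‖ ^ 2 + w y

/-- Real-valued convex functions with lower bound `-c` and upper bound `c * (1 + ‖x‖ ^ 2)`. -/
structure ConvexQuadBound {d : ℕ} (c : ℝ) (u : Euc d → ℝ) : Prop where
  convex : ConvexOn ℝ Set.univ u
  lower : ∀ x, -c ≤ u x
  upper : ∀ x, u x ≤ c * (1 + ‖x‖ ^ 2)

/-- `a` minimizes the one-step cost with running price `p` and continuation value `w` at `x`. -/
def IsOptimalMove {d : ℕ} (w : Euc d → ℝ) (p x a : Euc d) : Prop :=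
  ∀ a', (1 / 2) * ‖a‖ ^ 2 + ⟪a, p⟫ + w (x + a) ≤ (1 / 2) * ‖a'‖ ^ 2 + ⟪a', p⟫ + w (x + a')

lemma isOptimalMove_of_isProx {d : ℕ} {w : Euc d → ℝ} {p x a : Euc d}
    (h : IsProx w (x - p) (x + a)) : IsOptimalMove w p x a := by
  intro a'
  have h1 := h (x + a')
  have key : ∀ v : Euc d, ‖x - p - (x + v)‖ ^ 2 = ‖v‖ ^ 2 + 2 * ⟪v, p⟫ + ‖p‖ ^ 2 := by
    intro v
    rw [show x - p - (x + v) = -(v + p) by abel, norm_neg, norm_add_sq_real]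
  rw [key, key] at h1
  linarith

lemma norm_add_sq_le_two_mul {d : ℕ} (x y : Euc d) :
    ‖x + y‖ ^ 2 ≤ 2 * ‖x‖ ^ 2 + 2 * ‖y‖ ^ 2 := by
  have h1 := norm_add_le x y
  nlinarith [norm_nonneg (x + y), sq_nonneg (‖x‖ - ‖y‖)]

/-! ### The supremum step -/

section Supremum

variable {d : ℕ} {C c : ℝ} {u : Euc d → ℝ} {ξ : Measure (Euc d)} {M : Set (Measure (Euc d))}

/-- Probability measures with second moment at most `C`. -/
structure SecondMomentLE {d : ℕ} (C : ℝ) (ξ : Measure (Euc d)) : Prop where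
  isProb : IsProbabilityMeasure ξ
  integrable_sq : Integrable (fun y => ‖y‖ ^ 2) ξ
  integral_sq_le : ∫ y, ‖y‖ ^ 2 ∂ξ ≤ C

lemma SecondMomentLE.of_lintegral (hC : 0 ≤ C) (hξ : IsProbabilityMeasure ξ)
    (h : ∫⁻ y, (‖y‖₊ : ℝ≥0∞) ^ (2 : ℕ) ∂ξ ≤ ENNReal.ofReal C) : SecondMomentLE C ξ := by
  have heq : ∀ y : Euc d, ENNReal.ofReal (‖y‖ ^ 2) = (‖y‖₊ : ℝ≥0∞) ^ (2 : ℕ) := by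
    intro y
    rw [ENNReal.ofReal_pow (norm_nonneg y), ofReal_norm]
    rfl
  have hm : AEStronglyMeasurable (fun y : Euc d => ‖y‖ ^ 2) ξ := by fun_prop
  refine ⟨hξ, ⟨hm, ?_⟩, ?_⟩
  · rw [hasFiniteIntegral_iff_ofReal (Filter.Eventually.of_forall fun y => by positivity)]
    simp_rw [heq]
    exact h.trans_lt ENNReal.ofReal_lt_top
  · rw [integral_eq_lintegral_of_nonneg_ae (Filter.Eventually.of_forall fun y => by positivity) hm]
    simp_rw [heq]
    exact ENNReal.toReal_le_of_le_ofReal hC h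

lemma SecondMomentLE.integrable_quad (hξ : SecondMomentLE C ξ) (x : Euc d) :
    Integrable (fun y => 1 + ‖x + y‖ ^ 2) ξ := by
  have := hξ.isProb
  have h : Integrable (fun y => 1 + (2 * ‖x‖ ^ 2 + 2 * ‖y‖ ^ 2)) ξ :=
    (integrable_const _).add ((integrable_const _).add (hξ.integrable_sq.const_mul 2))
  refine h.mono' (by fun_prop) (Filter.Eventually.of_forall fun y => ?_)
  rw [Real.norm_of_nonneg (by positivity)]
  linarith [norm_add_sq_le_two_mul x y]

lemma SecondMomentLE.integral_quad_le (hξ : SecondMomentLE C ξ) (hC : 0 ≤ C) (x : Euc d) :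
    ∫ y, (1 + ‖x + y‖ ^ 2) ∂ξ ≤ (2 + 2 * C) * (1 + ‖x‖ ^ 2) := by
  have := hξ.isProb
  have h2 : Integrable (fun y => 2 * ‖y‖ ^ 2) ξ := hξ.integrable_sq.const_mul 2
  have h1 : Integrable (fun y => (1 + 2 * ‖x‖ ^ 2) + 2 * ‖y‖ ^ 2) ξ := (integrable_const _).add h2
  have h3 := integral_mono (hξ.integrable_quad x) h1 fun y => by
    have := norm_add_sq_le_two_mul x y
    dsimp only
    linarith
  rw [integral_add (integrable_const _) h2, integral_const_mul] at h3
  simp only [integral_const, probReal_univ, smul_eq_mul, one_mul] at h3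
  nlinarith [hξ.integral_sq_le, mul_nonneg hC (sq_nonneg ‖x‖)]

lemma ConvexQuadBound.abs_le_quad (hu : ConvexQuadBound c u) (hc : 0 ≤ c) (x : Euc d) :
    |u x| ≤ c * (1 + ‖x‖ ^ 2) :=
  abs_le.2 ⟨by nlinarith [hu.lower x, mul_nonneg hc (sq_nonneg ‖x‖)], hu.upper x⟩

lemma ConvexQuadBound.integrable (hu : ConvexQuadBound c u) (hc : 0 ≤ c)
    (hξ : SecondMomentLE C ξ) (x : Euc d) : Integrable (fun y => u (x + y)) ξ := by
  have hcont : Continuous u := continuousOn_univ.1 (hu.convex.continuousOn isOpen_univ)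
  refine ((hξ.integrable_quad x).const_mul c).mono' (by fun_prop)
    (Filter.Eventually.of_forall fun y => hu.abs_le_quad hc _)

lemma ConvexQuadBound.integral_le (hu : ConvexQuadBound c u) (hc : 0 ≤ c) (hC : 0 ≤ C)
    (hξ : SecondMomentLE C ξ) (x : Euc d) :
    ∫ y, u (x + y) ∂ξ ≤ c * (2 + 2 * C) * (1 + ‖x‖ ^ 2) := by
  have h := integral_mono (hu.integrable hc hξ x) ((hξ.integrable_quad x).const_mul c)
    fun y => hu.upper (x + y)
  rw [integral_const_mul] at h
  nlinarith [mul_le_mul_of_nonneg_left (hξ.integral_quad_le hC x) hc]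

lemma ConvexQuadBound.le_integral (hu : ConvexQuadBound c u) (hc : 0 ≤ c)
    (hξ : SecondMomentLE C ξ) (x : Euc d) : -c ≤ ∫ y, u (x + y) ∂ξ := by
  have := hξ.isProb
  have h := integral_mono (integrable_const (-c)) (hu.integrable hc hξ x)
    fun y => hu.lower (x + y)
  simpa using h

lemma ConvexQuadBound.bddAbove_integrals (hu : ConvexQuadBound c u) (hc : 0 ≤ c) (hC : 0 ≤ C)
    (hM : ∀ ξ ∈ M, SecondMomentLE C ξ) (x : Euc d) :
    BddAbove (Set.range fun ξ : M => ∫ y, u (x + y) ∂(ξ : Measure (Euc d))) :=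
  ⟨_, by rintro _ ⟨ξ, rfl⟩; exact hu.integral_le hc hC (hM ξ ξ.2) x⟩

lemma ConvexQuadBound.convexOn_integral (hu : ConvexQuadBound c u) (hc : 0 ≤ c)
    (hξ : SecondMomentLE C ξ) : ConvexOn ℝ Set.univ fun x => ∫ y, u (x + y) ∂ξ := by
  refine ⟨convex_univ, fun x _ x' _ s t hs ht hst => ?_⟩
  have h1 := (hu.integrable hc hξ x).const_mul s
  have h2 := (hu.integrable hc hξ x').const_mul t
  have h := integral_mono (hu.integrable hc hξ (s • x + t • x')) (h1.add h2) fun y => by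
    have h3 := hu.convex.2 (Set.mem_univ (x + y)) (Set.mem_univ (x' + y)) hs ht hst
    have h4 : s • (x + y) + t • (x' + y) = s • x + t • x' + y := by
      rw [smul_add, smul_add, add_add_add_comm, ← add_smul, hst, one_smul]
    rw [h4] at h3
    simpa using h3
  rw [integral_add' h1 h2, integral_const_mul, integral_const_mul] at h
  simpa using h

/-- Robust expectation preserves convexity and quadratic bounds. -/
lemma ConvexQuadBound.iSup_integral (hu : ConvexQuadBound c u) (hc : 0 ≤ c) (hC : 0 ≤ C)
    (hne : M.Nonempty) (hM : ∀ ξ ∈ M, SecondMomentLE C ξ) :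
    ConvexQuadBound (c * (2 + 2 * C))
      fun x => ⨆ ξ : M, ∫ y, u (x + y) ∂(ξ : Measure (Euc d)) := by
  have : Nonempty M := hne.to_subtype
  refine ⟨⟨convex_univ, fun x _ x' _ s t hs ht hst => ciSup_le fun ξ => ?_⟩, fun x => ?_,
    fun x => ciSup_le fun ξ => hu.integral_le hc hC (hM ξ ξ.2) x⟩
  · refine ((hu.convexOn_integral hc (hM ξ ξ.2)).2 (Set.mem_univ x) (Set.mem_univ x')
      hs ht hst).trans ?_
    exact add_le_add
      (mul_le_mul_of_nonneg_left (le_ciSup (hu.bddAbove_integrals hc hC hM x) ξ) hs)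
      (mul_le_mul_of_nonneg_left (le_ciSup (hu.bddAbove_integrals hc hC hM x') ξ) ht)
  · obtain ⟨ξ, hξ⟩ := hne
    have h1 := hu.le_integral hc (hM ξ hξ) x
    have h2 := le_ciSup (hu.bddAbove_integrals hc hC hM x) ⟨ξ, hξ⟩
    have h3 : c * 1 ≤ c * (2 + 2 * C) := mul_le_mul_of_nonneg_left (by linarith) hc
    dsimp only at h2
    linarith

lemma iSup_integral_le_add {u₁ u₂ : Euc d → ℝ} {e : ℝ} (h₁ : ConvexQuadBound c u₁)
    (h₂ : ConvexQuadBound c u₂) (hc : 0 ≤ c) (hC : 0 ≤ C) (he : 0 ≤ e)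
    (hne : M.Nonempty) (hM : ∀ ξ ∈ M, SecondMomentLE C ξ)
    (h : ∀ x, u₁ x ≤ u₂ x + e * (1 + ‖x‖ ^ 2)) (x : Euc d) :
    ⨆ ξ : M, ∫ y, u₁ (x + y) ∂(ξ : Measure (Euc d)) ≤
      (⨆ ξ : M, ∫ y, u₂ (x + y) ∂(ξ : Measure (Euc d))) +
        e * (2 + 2 * C) * (1 + ‖x‖ ^ 2) := by
  have : Nonempty M := hne.to_subtype
  refine ciSup_le fun ξ => ?_
  have hξ := hM ξ ξ.2
  have h3 := (hξ.integrable_quad x).const_mul e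
  have h4 := integral_mono (h₁.integrable hc hξ x) ((h₂.integrable hc hξ x).add h3)
    fun y => h (x + y)
  rw [integral_add' (h₂.integrable hc hξ x) h3, integral_const_mul] at h4
  have h5 := le_ciSup (h₂.bddAbove_integrals hc hC hM x) ξ
  nlinarith [mul_le_mul_of_nonneg_left (hξ.integral_quad_le hC x) he]

end Supremum

/-! ### The infimum step -/

section Infimum

variable {d : ℕ} {C c : ℝ} {w : Euc d → ℝ} {p x a : Euc d}

lemma neg_mul_norm_le_inner (hp : ‖p‖ ≤ C) (a : Euc d) : -(C * ‖a‖) ≤ ⟪a, p⟫ := by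
  have h1 := abs_le.1 (abs_real_inner_le_norm a p)
  nlinarith [mul_le_mul_of_nonneg_left hp (norm_nonneg a)]

lemma IsOptimalMove.sq_norm_le (h : IsOptimalMove w p x a) (hw : ConvexQuadBound c w)
    (hp : ‖p‖ ≤ C) (hc : 0 ≤ c) : ‖a‖ ^ 2 ≤ (4 * C ^ 2 + 8 * c) * (1 + ‖x‖ ^ 2) := by
  have h0 := h 0
  simp only [norm_zero, inner_zero_left, add_zero] at h0
  have h1 := neg_mul_norm_le_inner hp a
  nlinarith [hw.lower (x + a), hw.upper x, sq_nonneg (‖a‖ - 2 * C), mul_nonneg hc (sq_nonneg ‖x‖),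
    mul_nonneg (sq_nonneg C) (sq_nonneg ‖x‖)]

lemma IsOptimalMove.iInf_eq (h : IsOptimalMove w p x a) (f : ℝ) :
    ⨅ a' : Euc d, (1 / 2) * ‖a'‖ ^ 2 + ⟪a', p⟫ + f + w (x + a') =
      (1 / 2) * ‖a‖ ^ 2 + ⟪a, p⟫ + f + w (x + a) := by
  have hle : ∀ a', (1 / 2) * ‖a‖ ^ 2 + ⟪a, p⟫ + f + w (x + a) ≤
      (1 / 2) * ‖a'‖ ^ 2 + ⟪a', p⟫ + f + w (x + a') := fun a' => by linarith [h a']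
  exact le_antisymm (ciInf_le ⟨_, by rintro _ ⟨a', rfl⟩; exact hle a'⟩ a) (le_ciInf hle)

lemma norm_sq_combo_le (a b : Euc d) {s t : ℝ} (hs : 0 ≤ s) (ht : 0 ≤ t) (hst : s + t = 1) :
    ‖s • a + t • b‖ ^ 2 ≤ s * ‖a‖ ^ 2 + t * ‖b‖ ^ 2 := by
  have h : ConvexOn ℝ Set.univ fun v : Euc d => ‖v‖ ^ 2 :=
    (convexOn_univ_norm).pow (fun _ _ => norm_nonneg _) 2
  simpa using h.2 (Set.mem_univ a) (Set.mem_univ b) hs ht hst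

/-- The optimal one-step cost preserves convexity and quadratic bounds. -/
lemma ConvexQuadBound.optimalCost {f v : Euc d → ℝ} {α : Euc d → Euc d}
    (hw : ConvexQuadBound c w) (hf : ConvexQuadBound C f) (hp : ‖p‖ ≤ C)
    (hα : ∀ x, IsOptimalMove w p x (α x))
    (hv : ∀ x, v x = (1 / 2) * ‖α x‖ ^ 2 + ⟪α x, p⟫ + f x + w (x + α x)) :
    ConvexQuadBound (C ^ 2 / 2 + C + c) v := by
  refine ⟨⟨convex_univ, fun x _ y _ s t hs ht hst => ?_⟩, fun x => ?_, fun x => ?_⟩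
  · have h1 := hα (s • x + t • y) (s • α x + t • α y)
    have h2 := norm_sq_combo_le (α x) (α y) hs ht hst
    have h3 := hf.convex.2 (Set.mem_univ x) (Set.mem_univ y) hs ht hst
    have h4 := hw.convex.2 (Set.mem_univ (x + α x)) (Set.mem_univ (y + α y)) hs ht hst
    rw [show s • (x + α x) + t • (y + α y) = s • x + t • y + (s • α x + t • α y) by module] at h4
    rw [inner_add_left, inner_smul_left, inner_smul_left] at h1
    simp only [smul_eq_mul, RCLike.conj_to_real, hv] at *
    nlinarith
  · rw [hv]
    nlinarith [neg_mul_norm_le_inner hp (α x), hw.lower (x + α x), hf.lower x,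
      sq_nonneg (‖α x‖ - C)]
  · have h0 := hα x 0
    simp only [norm_zero, inner_zero_left, add_zero] at h0
    rw [hv]
    nlinarith [hw.upper x, hf.upper x, mul_nonneg (sq_nonneg C) (sq_nonneg ‖x‖), sq_nonneg C]

lemma optimalCost_le_add {w₁ w₂ : Euc d → ℝ} {p₁ p₂ a₁ a₂ : Euc d} {f₁ f₂ k δ : ℝ}
    (h₁ : IsOptimalMove w₁ p₁ x a₁) (h₂ : IsOptimalMove w₂ p₂ x a₂)
    (hw₂ : ConvexQuadBound c w₂) (hp₂ : ‖p₂‖ ≤ C)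
    (hc : 0 ≤ c) (hC : 0 ≤ C) (hk : 0 ≤ k) (hδ : 0 ≤ δ)
    (hp : ‖p₁ - p₂‖ ≤ C * δ) (hf : f₁ ≤ f₂ + C * δ * (1 + ‖x‖ ^ 2))
    (hw : ∀ x, w₁ x ≤ w₂ x + k * δ * (1 + ‖x‖ ^ 2)) :
    (1 / 2) * ‖a₁‖ ^ 2 + ⟪a₁, p₁⟫ + f₁ + w₁ (x + a₁) ≤
      (1 / 2) * ‖a₂‖ ^ 2 + ⟪a₂, p₂⟫ + f₂ + w₂ (x + a₂) +
        (C * (2 + (4 * C ^ 2 + 8 * c)) + k * (2 + 2 * (4 * C ^ 2 + 8 * c))) * δ *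
          (1 + ‖x‖ ^ 2) := by
  have hL := h₂.sq_norm_le hw₂ hp₂ hc
  set L := 4 * C ^ 2 + 8 * c with hLdef
  have hL0 : 0 ≤ L := by positivity
  have hCδ : 0 ≤ C * δ := mul_nonneg hC hδ
  have hkδ : 0 ≤ k * δ := mul_nonneg hk hδ
  have hin : ⟪a₂, p₁⟫ ≤ ⟪a₂, p₂⟫ + C * δ * ((1 + L) * (1 + ‖x‖ ^ 2)) := by
    have h3 : ⟪a₂, p₁⟫ - ⟪a₂, p₂⟫ ≤ ‖a₂‖ * (C * δ) := by
      rw [← inner_sub_right]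
      exact (real_inner_le_norm _ _).trans (mul_le_mul_of_nonneg_left hp (norm_nonneg _))
    have h4 : ‖a₂‖ ≤ (1 + L) * (1 + ‖x‖ ^ 2) := by nlinarith [sq_nonneg (‖a₂‖ - 1), sq_nonneg ‖x‖]
    nlinarith [mul_le_mul_of_nonneg_right h4 hCδ]
  have hwx : w₁ (x + a₂) ≤ w₂ (x + a₂) + k * δ * ((2 + 2 * L) * (1 + ‖x‖ ^ 2)) := by
    have h5 : 1 + ‖x + a₂‖ ^ 2 ≤ (2 + 2 * L) * (1 + ‖x‖ ^ 2) := by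
      nlinarith [norm_add_sq_le_two_mul x a₂]
    linarith [hw (x + a₂), mul_le_mul_of_nonneg_left h5 hkδ]
  linarith [h₁ a₂]

/-- Strong convexity of the one-step cost at its minimizer. -/
lemma IsOptimalMove.add_sq_le (h : IsOptimalMove w p x a) (hw : ConvexOn ℝ Set.univ w)
    (b : Euc d) :
    (1 / 2) * ‖a‖ ^ 2 + ⟪a, p⟫ + w (x + a) + (1 / 2) * ‖b - a‖ ^ 2 ≤
      (1 / 2) * ‖b‖ ^ 2 + ⟪b, p⟫ + w (x + b) := by
  have key : ∀ s : ℝ, 0 < s → s ≤ 1 →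
      (1 / 2) * ‖a‖ ^ 2 + ⟪a, p⟫ + w (x + a) + (1 / 2) * ‖b - a‖ ^ 2 ≤
        (1 / 2) * ‖b‖ ^ 2 + ⟪b, p⟫ + w (x + b) + s * ((1 / 2) * ‖b - a‖ ^ 2) := by
    intro s hs hs1
    have h1 := h ((1 - s) • a + s • b)
    have h2 := hw.2 (Set.mem_univ (x + a)) (Set.mem_univ (x + b)) (sub_nonneg.2 hs1) hs.le
      (by ring)
    rw [show (1 - s) • (x + a) + s • (x + b) = x + ((1 - s) • a + s • b) by module] at h2
    rw [inner_add_left, inner_smul_left, inner_smul_left] at h1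
    have h3 : ‖(1 - s) • a + s • b‖ ^ 2 =
        (1 - s) * ‖a‖ ^ 2 + s * ‖b‖ ^ 2 - s * (1 - s) * ‖b - a‖ ^ 2 := by
      rw [norm_add_sq_real, norm_sub_sq_real, norm_smul, norm_smul, inner_smul_left,
        inner_smul_right, mul_pow, mul_pow, Real.norm_eq_abs, Real.norm_eq_abs, sq_abs, sq_abs,
        real_inner_comm a b]
      simp only [RCLike.conj_to_real]
      ring
    rw [h3] at h1
    simp only [smul_eq_mul, RCLike.conj_to_real] at h1 h2
    have h4 : s * ((1 / 2) * ‖a‖ ^ 2 + ⟪a, p⟫ + w (x + a) + (1 / 2) * ‖b - a‖ ^ 2) ≤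
        s * ((1 / 2) * ‖b‖ ^ 2 + ⟪b, p⟫ + w (x + b) + s * ((1 / 2) * ‖b - a‖ ^ 2)) := by
      linarith
    exact le_of_mul_le_mul_left h4 hs
  refine ge_of_tendsto (x := nhdsWithin (0 : ℝ) (Set.Ioi 0))
    (f := fun s => (1 / 2) * ‖b‖ ^ 2 + ⟪b, p⟫ + w (x + b) + s * ((1 / 2) * ‖b - a‖ ^ 2)) ?_ ?_
  · have hcont : Continuous fun s : ℝ =>
        (1 / 2) * ‖b‖ ^ 2 + ⟪b, p⟫ + w (x + b) + s * ((1 / 2) * ‖b - a‖ ^ 2) := by fun_prop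
    simpa using (hcont.tendsto 0).mono_left nhdsWithin_le_nhds
  · filter_upwards [Ioc_mem_nhdsGT (zero_lt_one (α := ℝ))] with s hs using key s hs.1 hs.2

lemma le_add_of_sq_le {r A B : ℝ} (hB : 0 ≤ B) (hA : 0 ≤ A) (h : r ^ 2 ≤ A * r + B ^ 2) :
    r ≤ A + B := by
  by_contra! hlt
  nlinarith [mul_nonneg hA hB]

/-- Stability of the minimizers, with a Hölder exponent `1/2` coming from strong convexity. -/
lemma norm_sub_le_of_isOptimalMove {w₁ w₂ : Euc d → ℝ} {p₁ p₂ a₁ a₂ : Euc d} {k δ : ℝ}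
    (h₁ : IsOptimalMove w₁ p₁ x a₁) (h₂ : IsOptimalMove w₂ p₂ x a₂)
    (hw₁ : ConvexQuadBound c w₁) (hw₂ : ConvexQuadBound c w₂)
    (hp₁ : ‖p₁‖ ≤ C) (hp₂ : ‖p₂‖ ≤ C)
    (hc : 0 ≤ c) (hC : 0 ≤ C) (hk : 0 ≤ k) (hδ : 0 ≤ δ)
    (hp : ‖p₁ - p₂‖ ≤ C * δ) (hw : ∀ x, |w₁ x - w₂ x| ≤ k * δ * (1 + ‖x‖ ^ 2)) :
    ‖a₁ - a₂‖ ≤ (C + 1 + 2 * k * (2 + 2 * (4 * C ^ 2 + 8 * c))) *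
      (Real.sqrt δ + δ) * (1 + ‖x‖) := by
  have hL₁ := h₁.sq_norm_le hw₁ hp₁ hc
  have hL₂ := h₂.sq_norm_le hw₂ hp₂ hc
  set L := 4 * C ^ 2 + 8 * c with hLdef
  have hL0 : 0 ≤ L := by positivity
  have hkδ : 0 ≤ k * δ := mul_nonneg hk hδ
  have hval : ∀ a : Euc d, ‖a‖ ^ 2 ≤ L * (1 + ‖x‖ ^ 2) →
      |w₁ (x + a) - w₂ (x + a)| ≤ k * δ * ((2 + 2 * L) * (1 + ‖x‖ ^ 2)) := by
    intro a ha
    refine (hw (x + a)).trans (mul_le_mul_of_nonneg_left ?_ hkδ)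
    nlinarith [norm_add_sq_le_two_mul x a]
  have hin : ⟪a₂ - a₁, p₁ - p₂⟫ ≤ ‖a₁ - a₂‖ * (C * δ) := by
    rw [norm_sub_rev a₁ a₂]
    exact (real_inner_le_norm _ _).trans (mul_le_mul_of_nonneg_left hp (norm_nonneg _))
  simp only [inner_sub_left, inner_sub_right] at hin
  have s₁ := h₁.add_sq_le hw₁.convex a₂
  have s₂ := h₂.add_sq_le hw₂.convex a₁
  rw [norm_sub_rev a₂ a₁] at s₁
  have v₁ := abs_le.1 (hval a₁ hL₁)
  have v₂ := abs_le.1 (hval a₂ hL₂)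
  set r := ‖a₁ - a₂‖
  set K := 2 * k * (2 + 2 * L) with hK
  have hK0 : 0 ≤ K := by positivity
  have hr0 : 0 ≤ r := norm_nonneg _
  have quad : r ^ 2 ≤ C * δ * r + K * δ * (1 + ‖x‖ ^ 2) := by rw [hK]; linarith [v₁.1, v₂.2]
  have hs0 : 0 ≤ Real.sqrt δ := Real.sqrt_nonneg δ
  have hss : Real.sqrt δ ^ 2 = δ := Real.sq_sqrt hδ
  set q := Real.sqrt δ
  have hx0 := norm_nonneg x
  have hCδ : 0 ≤ C * δ := mul_nonneg hC hδ
  have hbound : r ≤ C * δ + (1 + K) * q * (1 + ‖x‖) := by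
    have h4 : K * δ * (1 + ‖x‖ ^ 2) ≤ ((1 + K) * q * (1 + ‖x‖)) ^ 2 := by
      rw [mul_pow, mul_pow, hss]
      have h5 : K ≤ (1 + K) ^ 2 := by linarith [sq_nonneg K, add_sq 1 K]
      have h6 : 1 + ‖x‖ ^ 2 ≤ (1 + ‖x‖) ^ 2 := by linarith [add_sq 1 ‖x‖]
      gcongr
    exact le_add_of_sq_le (by positivity) hCδ (quad.trans (by gcongr))
  have hA : 0 ≤ C * δ * ‖x‖ := by positivity
  have hB : 0 ≤ C * q * (1 + ‖x‖) := by positivity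
  have hD : 0 ≤ (1 + K) * δ * (1 + ‖x‖) := by positivity
  linarith

end Infimum

/-! ### Backward induction -/

/-- Solution of the recursion, with optimal moves, for data satisfying the growth assumptions. -/
structure ControlledRecursion (T : ℕ) (C : ℝ) {d : ℕ} (M : ℕ → Set (Measure (Euc d)))
    (f : ℕ → Euc d → ℝ) (p : ℕ → Euc d) (u ubar : ℕ → Euc d → ℝ) (α : ℕ → Euc d → Euc d) :
    Prop where
  nonempty : ∀ t < T, (M t).Nonempty
  moment : ∀ t < T, ∀ ξ ∈ M t, SecondMomentLE C ξ
  cost : ∀ t ≤ T, ConvexQuadBound C (f t)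
  price : ∀ t < T, ‖p t‖ ≤ C
  terminal : u T = f T
  ubar_eq : ∀ t < T, ubar (t + 1) =
    fun x => ⨆ ξ : M t, ∫ y, u (t + 1) (x + y) ∂(ξ : Measure (Euc d))
  optimal : ∀ t < T, ∀ x, IsOptimalMove (ubar (t + 1)) (p t) x (α t x)
  u_eq : ∀ t < T, ∀ x, u t x =
    (1 / 2) * ‖α t x‖ ^ 2 + ⟪α t x, p t⟫ + f t x + ubar (t + 1) (x + α t x)

/-- Two controlled recursions over the same ambiguity sets whose data differ by at most `δ`. -/
structure CloseRecursions (T : ℕ) (C : ℝ) {d : ℕ} (M : ℕ → Set (Measure (Euc d)))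
    (f₁ f₂ : ℕ → Euc d → ℝ) (p₁ p₂ : ℕ → Euc d) (u₁ ubar₁ u₂ ubar₂ : ℕ → Euc d → ℝ)
    (α₁ α₂ : ℕ → Euc d → Euc d) (δ : ℝ) : Prop where
  first : ControlledRecursion T C M f₁ p₁ u₁ ubar₁ α₁
  second : ControlledRecursion T C M f₂ p₂ u₂ ubar₂ α₂
  nonneg : 0 ≤ δ
  cost_close : ∀ t ≤ T, ∀ x, |f₁ t x - f₂ t x| ≤ C * δ * (1 + ‖x‖ ^ 2)
  price_close : ∀ t < T, ‖p₁ t - p₂ t‖ ≤ C * δ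

section BackwardInduction

variable {T d : ℕ} {C c k δ : ℝ} {M : ℕ → Set (Measure (Euc d))}
  {f₁ f₂ : ℕ → Euc d → ℝ} {p₁ p₂ : ℕ → Euc d} {u₁ ubar₁ u₂ ubar₂ : ℕ → Euc d → ℝ}
  {α₁ α₂ : ℕ → Euc d → Euc d}

/-- `v₁` and `v₂` are convex with growth constant `c`, and are `k * δ`-close. -/
structure CloseValues {d : ℕ} (c k δ : ℝ) (v₁ v₂ : Euc d → ℝ) : Prop where
  first : ConvexQuadBound c v₁
  second : ConvexQuadBound c v₂
  close : ∀ x, |v₁ x - v₂ x| ≤ k * δ * (1 + ‖x‖ ^ 2)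

lemma CloseValues.symm {v₁ v₂ : Euc d → ℝ} (h : CloseValues c k δ v₁ v₂) :
    CloseValues c k δ v₂ v₁ :=
  ⟨h.second, h.first, fun x => by rw [abs_sub_comm]; exact h.close x⟩

lemma CloseValues.le {v₁ v₂ : Euc d → ℝ} (h : CloseValues c k δ v₁ v₂) (x : Euc d) :
    v₁ x ≤ v₂ x + k * δ * (1 + ‖x‖ ^ 2) := by
  linarith [(abs_le.1 (h.close x)).2]

lemma CloseRecursions.symm
    (h : CloseRecursions T C M f₁ f₂ p₁ p₂ u₁ ubar₁ u₂ ubar₂ α₁ α₂ δ) :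
    CloseRecursions T C M f₂ f₁ p₂ p₁ u₂ ubar₂ u₁ ubar₁ α₂ α₁ δ :=
  ⟨h.second, h.first, h.nonneg, fun t ht x => by rw [abs_sub_comm]; exact h.cost_close t ht x,
    fun t ht => by rw [norm_sub_rev]; exact h.price_close t ht⟩

lemma CloseRecursions.closeValues_ubar
    (h : CloseRecursions T C M f₁ f₂ p₁ p₂ u₁ ubar₁ u₂ ubar₂ α₁ α₂ δ) (hC : 0 ≤ C)
    (hc : 0 ≤ c) (hk : 0 ≤ k) {t : ℕ} (ht : t < T)
    (hu : CloseValues c k δ (u₁ (t + 1)) (u₂ (t + 1))) :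
    CloseValues (c * (2 + 2 * C)) (k * (2 + 2 * C)) δ (ubar₁ (t + 1)) (ubar₂ (t + 1)) := by
  have hne := h.first.nonempty t ht
  have hM := h.first.moment t ht
  have hkδ := mul_nonneg hk h.nonneg
  rw [h.first.ubar_eq t ht, h.second.ubar_eq t ht]
  refine ⟨hu.first.iSup_integral hc hC hne hM, hu.second.iSup_integral hc hC hne hM,
    fun x => abs_le.2 ⟨?_, ?_⟩⟩
  · linarith [iSup_integral_le_add hu.second hu.first hc hC hkδ hne hM hu.symm.le x]
  · linarith [iSup_integral_le_add hu.first hu.second hc hC hkδ hne hM hu.le x]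

lemma CloseRecursions.closeValues_u
    (h : CloseRecursions T C M f₁ f₂ p₁ p₂ u₁ ubar₁ u₂ ubar₂ α₁ α₂ δ) (hC : 0 ≤ C)
    (hc : 0 ≤ c) (hk : 0 ≤ k) {t : ℕ} (ht : t < T)
    (hw : CloseValues c k δ (ubar₁ (t + 1)) (ubar₂ (t + 1))) :
    CloseValues (C ^ 2 / 2 + C + c)
      (C * (2 + (4 * C ^ 2 + 8 * c)) + k * (2 + 2 * (4 * C ^ 2 + 8 * c))) δ (u₁ t) (u₂ t) := by
  have hp₁ := h.first.price t ht
  have hp₂ := h.second.price t ht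
  have o₁ := h.first.optimal t ht
  have o₂ := h.second.optimal t ht
  refine ⟨hw.first.optimalCost (h.first.cost t ht.le) hp₁ o₁ (h.first.u_eq t ht),
    hw.second.optimalCost (h.second.cost t ht.le) hp₂ o₂ (h.second.u_eq t ht),
    fun x => abs_le.2 ?_⟩
  rw [h.first.u_eq t ht, h.second.u_eq t ht]
  have hf := abs_le.1 (h.cost_close t ht.le x)
  constructor
  · linarith [optimalCost_le_add (f₁ := f₂ t x) (f₂ := f₁ t x) (o₂ x) (o₁ x) hw.first hp₁ hc hC hk
      h.nonneg (h.symm.price_close t ht) (by linarith) hw.symm.le]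
  · linarith [optimalCost_le_add (f₁ := f₁ t x) (f₂ := f₂ t x) (o₁ x) (o₂ x) hw.second hp₂ hc hC hk
      h.nonneg (h.price_close t ht) (by linarith) hw.le]

end BackwardInduction

/-- Growth and stability constants of the value function, depending only on `C` and the number
of remaining steps. -/
lemma exists_closeValues_u (T : ℕ) {C : ℝ} (hC : 0 < C) (n : ℕ) :
    ∃ c k : ℝ, 0 ≤ c ∧ 0 ≤ k ∧ ∀ (d : ℕ) (M : ℕ → Set (Measure (Euc d)))
      (f₁ f₂ : ℕ → Euc d → ℝ) (p₁ p₂ : ℕ → Euc d) (u₁ ubar₁ u₂ ubar₂ : ℕ → Euc d → ℝ)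
      (α₁ α₂ : ℕ → Euc d → Euc d) (δ : ℝ),
      CloseRecursions T C M f₁ f₂ p₁ p₂ u₁ ubar₁ u₂ ubar₂ α₁ α₂ δ →
      ∀ t, t + n = T → CloseValues c k δ (u₁ t) (u₂ t) := by
  induction n with
  | zero =>
    refine ⟨C, C, hC.le, hC.le, fun d M f₁ f₂ p₁ p₂ u₁ ubar₁ u₂ ubar₂ α₁ α₂ δ h t ht => ?_⟩
    obtain rfl : t = T := ht
    rw [h.first.terminal, h.second.terminal]
    exact ⟨h.first.cost t le_rfl, h.second.cost t le_rfl, h.cost_close t le_rfl⟩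
  | succ n ih =>
    obtain ⟨c, k, hc, hk, ih⟩ := ih
    refine ⟨_, _, ?_, ?_, fun d M f₁ f₂ p₁ p₂ u₁ ubar₁ u₂ ubar₂ α₁ α₂ δ h t ht =>
      h.closeValues_u hC.le ?_ ?_ (by omega)
        (h.closeValues_ubar hC.le hc hk (by omega) (ih _ _ _ _ _ _ _ _ _ _ _ _ _ h (t + 1)
          (by omega)))⟩ <;> positivity

lemma exists_feedback_bound (T : ℕ) {C : ℝ} (hC : 0 < C) {t : ℕ} (ht : t < T) :
    ∃ C' : ℝ, 0 < C' ∧ ∀ (d : ℕ) (M : ℕ → Set (Measure (Euc d)))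
      (f₁ f₂ : ℕ → Euc d → ℝ) (p₁ p₂ : ℕ → Euc d) (u₁ ubar₁ u₂ ubar₂ : ℕ → Euc d → ℝ)
      (α₁ α₂ : ℕ → Euc d → Euc d) (δ : ℝ),
      CloseRecursions T C M f₁ f₂ p₁ p₂ u₁ ubar₁ u₂ ubar₂ α₁ α₂ δ →
      ∀ x, ‖α₁ t x - α₂ t x‖ ≤ C' * (Real.sqrt δ + δ) * (1 + ‖x‖) := by
  obtain ⟨c, k, hc, hk, hu⟩ := exists_closeValues_u T hC (T - (t + 1))
  refine ⟨C + 1 + 2 * (k * (2 + 2 * C)) * (2 + 2 * (4 * C ^ 2 + 8 * (c * (2 + 2 * C)))),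
    by positivity, fun d M f₁ f₂ p₁ p₂ u₁ ubar₁ u₂ ubar₂ α₁ α₂ δ h x => ?_⟩
  have hw := h.closeValues_ubar hC.le hc hk ht
    (hu _ _ _ _ _ _ _ _ _ _ _ _ _ h (t + 1) (by omega))
  exact norm_sub_le_of_isOptimalMove (h.first.optimal t ht x) (h.second.optimal t ht x)
    hw.first hw.second (h.first.price t ht) (h.second.price t ht) (by positivity) hC.le
    (by positivity) h.nonneg (h.price_close t ht) hw.close

/-- Stability of the optimal feedback with respect to the belief:
under the standing assumptions, there is `C' > 0` depending only on `C` and `T` such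
that for any beliefs `b₁, b₂`, corresponding solutions `(uᵢ, ūᵢ)` of the dynamic
programming recursion, and associated optimal feedbacks
`αᵢ(t,x) = prox_{ūᵢ(t+1,·)}(x − P(t,bᵢ)) − x`, one has
`‖α₁(t,·) − α₂(t,·)‖_{𝒢,1} ≤ C′·(d₁(b₁,b₂)^{1/2} + d₁(b₁,b₂))`. -/
theorem feedback_stability (T : ℕ) (C : ℝ) (hT : 0 < T) (hC : 0 < C) :
    ∃ C' : ℝ, 0 < C' ∧
      ∀ (d : ℕ) (M : ℕ → Set (Measure (Euc d)))
        (F : ℕ → Euc d → B2 T d → ℝ) (P : ℕ → B2 T d → Euc d),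
        (∀ t < T, (M t).Nonempty) →
        (∀ t < T, ∀ ξ ∈ M t, IsProbabilityMeasure ξ ∧
          ∫⁻ y, (‖y‖₊ : ℝ≥0∞) ^ (2 : ℕ) ∂ξ ≤ ENNReal.ofReal C) →
        (∀ t ≤ T, ∀ b : B2 T d, MemB2 b → ConvexOn ℝ Set.univ (fun x => F t x b) ∧
          ∀ x, -C ≤ F t x b ∧ F t x b ≤ C * (1 + ‖x‖ ^ 2)) →
        (∀ t ≤ T, ∀ b₁ b₂ : B2 T d, MemB2 b₁ → MemB2 b₂ →
          ∀ x, |F t x b₁ - F t x b₂| ≤ C * d1B b₁ b₂ * (1 + ‖x‖ ^ 2)) →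
        (∀ t < T, ∀ b₁ b₂ : B2 T d, MemB2 b₁ → MemB2 b₂ →
          ‖P t b₁ - P t b₂‖ ≤ C * d1B b₁ b₂) →
        (∀ t < T, ∀ b : B2 T d, MemB2 b → ‖P t b‖ ≤ C) →
        ∀ b₁ b₂ : B2 T d, MemB2 b₁ → MemB2 b₂ →
        ∀ u₁ ubar₁ u₂ ubar₂ : ℕ → Euc d → ℝ,
          IsDPRecursion T M (fun t x => F t x b₁) (fun t => P t b₁) u₁ ubar₁ →
          IsDPRecursion T M (fun t x => F t x b₂) (fun t => P t b₂) u₂ ubar₂ →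
        ∀ α₁ α₂ : ℕ → Euc d → Euc d,
          (∀ t < T, ∀ x, IsProx (ubar₁ (t + 1)) (x - P t b₁) (x + α₁ t x)) →
          (∀ t < T, ∀ x, IsProx (ubar₂ (t + 1)) (x - P t b₂) (x + α₂ t x)) →
          ∀ t < T, ∀ x, ‖α₁ t x - α₂ t x‖ ≤
            C' * (Real.sqrt (d1B b₁ b₂) + d1B b₁ b₂) * (1 + ‖x‖) := by
  have hex : ∀ t : Fin T, _ := fun t => exists_feedback_bound T hC t.2
  choose K hK hbound using hex
  have hT' : Nonempty (Fin T) := ⟨⟨0, hT⟩⟩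
  refine ⟨∑ t, K t, Finset.sum_pos (fun t _ => hK t) Finset.univ_nonempty, ?_⟩
  intro d M F P hne hM hF hFd hPd hP b₁ b₂ hb₁ hb₂ u₁ ubar₁ u₂ ubar₂ r₁ r₂ α₁ α₂ hα₁ hα₂ t ht x
  have hδ : 0 ≤ d1B b₁ b₂ :=
    nonneg_of_mul_nonneg_right ((norm_nonneg _).trans (hPd 0 hT b₁ b₂ hb₁ hb₂)) hC
  have mk : ∀ (b : B2 T d) (u ubar : ℕ → Euc d → ℝ) (α : ℕ → Euc d → Euc d), MemB2 b →
      IsDPRecursion T M (fun t x => F t x b) (fun t => P t b) u ubar →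
      (∀ t < T, ∀ x, IsProx (ubar (t + 1)) (x - P t b) (x + α t x)) →
      ControlledRecursion T C M (fun t x => F t x b) (fun t => P t b) u ubar α := by
    intro b u ubar α hb hr hα
    obtain ⟨-, -, hterm, hubar, hu⟩ := hr
    have hopt : ∀ t < T, ∀ x, IsOptimalMove (ubar (t + 1)) (P t b) x (α t x) :=
      fun t ht x => isOptimalMove_of_isProx (hα t ht x)
    exact {
      nonempty := hne
      moment := fun t ht ξ hξ => .of_lintegral hC.le (hM t ht ξ hξ).1 (hM t ht ξ hξ).2
      cost := fun t ht => ⟨(hF t ht b hb).1, fun x => ((hF t ht b hb).2 x).1,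
        fun x => ((hF t ht b hb).2 x).2⟩
      price := fun t ht => hP t ht b hb
      terminal := funext hterm
      ubar_eq := fun t ht => funext (hubar t ht)
      optimal := hopt
      u_eq := fun t ht x => (hu t ht x).trans ((hopt t ht x).iInf_eq _) }
  have h := hbound ⟨t, ht⟩ d M _ _ _ _ _ _ _ _ _ _ _
    ⟨mk b₁ u₁ ubar₁ α₁ hb₁ r₁ hα₁, mk b₂ u₂ ubar₂ α₂ hb₂ r₂ hα₂, hδ,
      fun t ht => hFd t ht b₁ b₂ hb₁ hb₂, fun t ht => hPd t ht b₁ b₂ hb₁ hb₂⟩ x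
  refine h.trans ?_
  have hle : K ⟨t, ht⟩ ≤ ∑ t, K t :=
    Finset.single_le_sum (fun s _ => (hK s).le) (Finset.mem_univ _)
  gcongr
end

section
/- Let T ∈ ℕ* and C > 0. Suppose: m̄ ∈ 𝒫₂^C(ℝ^d); ν(t) ∈ 𝒫₂^C(ℝ^d) for each t ∈ {0,…,T−1}; for each t ∈ {0,…,T−1}, M_t is a nonempty subset of 𝒫₂^C(ℝ^d); B₂ := (𝒫₂(ℝ^{2d}))^T × 𝒫₂(ℝ^d) is equipped with d₁(b,b') defined as the sum of the componentwise Kantorovich–Rubinstein distances; F : {0,…,T} × ℝ^d × B₂ → ℝ and P : {0,…,T−1} × B₂ → ℝ^d satisfy, for all t and b₁, b₂ ∈ B₂: F(t,·,b₁) is convex with −C ≤ F(t,x,b₁) ≤ C(1+|x|²), ‖F(t,·,b₁)−F(t,·,b₂)‖_{𝒢,2} ≤ C·d₁(b₁,b₂), |P(t,b₁)−P(t,b₂)| ≤ C·d₁(b₁,b₂), and |P(t,b₁)| ≤ C. Set ℓ(t,x,a,b) := ½|a|² + ⟨a, P(t,b)⟩ + F(t,x,b). Then there exist constants C_u, C_α,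 C_b > 0 depending only on C and T, and a quintuple (u, α, m, μ, b), with each u(t,·) : ℝ^d → ℝ convex satisfying −C_u ≤ u(t,x) ≤ C_u(1+|x|²), each α_t : ℝ^d → ℝ^d 1-Lipschitz with |α_t(x)| ≤ C_α(1+|x|), each m(t) a Borel probability measure on ℝ^d with second moment at most C_b, each μ(t) a Borel probability measure on ℝ^{2d} with second moment at most C_b, and b ∈ B₂, such that for all t ∈ {0,…,T−1} and x ∈ ℝ^d: (i) u(t,x) = inf_{a∈ℝ^d} ( ℓ(t,x,a,b) + sup_{ξ∈M_t} ∫ u(t+1, x+a+y) dξ(y) ) and u(T,x) = F(T,x,b); (ii) α_t(x) is the unique minimizer of a ↦ ℓ(t,x,a,b) + sup_{ξ∈M_t} ∫ u(t+1, x+a+y) dξ(y); (iii) m(0) = m̄ and m(t+1) = ν(t) ∗ ((id + α_t)♯m(t)); (iv) μ(t) = (id, α_t)♯m(t); (v) b = (μ(0), …, μ(T−1), m(T)). -/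
open MeasureTheory ENNReal
open scoped RealInnerProductSpace

/-- The convolution of two measures: the image of the product measure under addition. -/
noncomputable def mconv {d : ℕ} (μ ν : Measure (Euc d)) : Measure (Euc d) :=
  Measure.map (fun q : Euc d × Euc d => q.1 + q.2) (μ.prod ν)

/-- The pair map `x ↦ (x, α(x)) : ℝ^d → ℝ^{2d}`. -/
noncomputable def pairMap {d : ℕ} (α : Euc d → Euc d) (x : Euc d) : Euc2 d :=
  (WithLp.equiv 2 (Euc d × Euc d)).symm (x, α x)

/-- The risk-averse cost minimized by a representative agent at time `t`:
`a ↦ ℓ(t,x,a,b) + sup_{ξ∈M_t} ∫ u(t+1, x+a+y) dξ(y)` where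
`ℓ(t,x,a,b) = ½|a|² + ⟨a, P(t,b)⟩ + F(t,x,b)`. -/
noncomputable def mfgCost {d : ℕ} (Mt : Set (Measure (Euc d))) (Pt : Euc d)
    (Ftx : ℝ) (unext : Euc d → ℝ) (x a : Euc d) : ℝ :=
  (1 / 2) * ‖a‖ ^ 2 + ⟪a, Pt⟫ + Ftx +
    ⨆ ξ : Mt, ∫ y, unext (x + a + y) ∂(ξ : Measure (Euc d))

section Retraction

open Metric Set Polynomial

/-- The determinant of `1 + t • A` is a polynomial in `t` of degree at most the dimension. -/
lemma exists_polynomial_det_one_add_smul {E : Type*} [NormedAddCommGroup E] [NormedSpace ℝ E]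
    [FiniteDimensional ℝ E] (A : E →L[ℝ] E) :
    ∃ p : ℝ[X], p.natDegree ≤ Module.finrank ℝ E ∧
      ∀ t : ℝ, (ContinuousLinearMap.id ℝ E + t • A).det = p.eval t := by
  classical
  let b := Module.finBasis ℝ E
  let M := LinearMap.toMatrix b b (A : E →ₗ[ℝ] E)
  refine ⟨Matrix.det ((X : ℝ[X]) • M.map C + (1 : Matrix _ _ ℝ).map C), ?_, fun t => ?_⟩
  · simpa using natDegree_det_X_add_C_le M 1
  · rw [← coe_evalRingHom, RingHom.map_det, ContinuousLinearMap.det, ← LinearMap.det_toMatrix b]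
    congr 1
    ext i j
    by_cases hij : i = j
    · subst hij
      simp [M, LinearMap.toMatrix_apply]
      ring
    · simp [M, LinearMap.toMatrix_apply, hij]
      ring

lemma det_id_add_smul_pos {E : Type*} [NormedAddCommGroup E] [NormedSpace ℝ E]
    [FiniteDimensional ℝ E] (A : E →L[ℝ] E) {t : ℝ} (ht : 0 ≤ t) (hA : t * ‖A‖ < 1) :
    0 < (ContinuousLinearMap.id ℝ E + t • A).det := by
  obtain ⟨p, -, hp⟩ := exists_polynomial_det_one_add_smul A
  have hne : ∀ s ∈ Icc 0 t, p.eval s ≠ 0 := by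
    intro s hs h0
    rw [← hp, ContinuousLinearMap.det] at h0
    have hlt := LinearMap.bot_lt_ker_of_det_eq_zero h0
    obtain ⟨v, hv, hv0⟩ := (Submodule.ne_bot_iff _).1 hlt.ne'
    have hv' : v + s • A v = 0 := by simpa using hv
    have h1 : ‖v‖ = s * ‖A v‖ := by
      have := congrArg norm (eq_neg_of_add_eq_zero_left hv')
      rwa [norm_neg, norm_smul, Real.norm_of_nonneg hs.1] at this
    have h2 := A.le_opNorm v
    have h3 : 0 < ‖v‖ := norm_pos_iff.2 hv0
    have h4 : s * ‖A‖ ≤ t * ‖A‖ := mul_le_mul_of_nonneg_right hs.2 (norm_nonneg _)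
    nlinarith [mul_le_mul_of_nonneg_left h2 hs.1]
  have h0 : p.eval 0 = 1 := by rw [← hp]; simp [ContinuousLinearMap.det]
  rw [hp]
  by_contra! hneg
  obtain ⟨s, hs, hs0⟩ := intermediate_value_Icc' ht p.continuous.continuousOn
    (show (0 : ℝ) ∈ Icc (p.eval t) (p.eval 0) from ⟨hneg, by rw [h0]; exact zero_le_one⟩)
  exact hne s hs hs0

lemma exists_mem_segment_norm_eq {E : Type*} [NormedAddCommGroup E] [NormedSpace ℝ E]
    {x y : E} {r : ℝ} (hx : ‖x‖ ≤ r) (hy : r ≤ ‖y‖) : ∃ z, ‖z‖ = r ∧ dist x z ≤ dist x y := by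
  have hc : Continuous fun s : ℝ => ‖AffineMap.lineMap x y s‖ :=
    continuous_norm.comp (AffineMap.lineMap_continuous)
  obtain ⟨s, hs, hs0⟩ := intermediate_value_Icc zero_le_one hc.continuousOn
    (show r ∈ Icc _ _ from ⟨by simpa using hx, by simpa using hy⟩)
  refine ⟨AffineMap.lineMap x y s, hs0, ?_⟩
  rw [dist_left_lineMap, Real.norm_of_nonneg hs.1]
  exact mul_le_of_le_one_left dist_nonneg hs.2

variable {E : Type*} [NormedAddCommGroup E] [InnerProductSpace ℝ E] [FiniteDimensional ℝ E]

/-- A Lipschitz perturbation of the identity of the unit ball that vanishes on the sphere is a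
bijection of the ball, provided its Lipschitz constant is less than one. -/
lemma image_closedBall_id_add {g : E → E} {L : NNReal} (hL : L < 1)
    (hg : LipschitzOnWith L g (closedBall 0 1)) (hg0 : ∀ x ∈ sphere (0 : E) 1, g x = 0) :
    InjOn (fun x => x + g x) (closedBall 0 1) ∧
      closedBall 0 1 ⊆ (fun x => x + g x) '' closedBall 0 1 := by
  classical
  have hL' : (L : ℝ) < 1 := by exact_mod_cast hL
  constructor
  · intro x hx y hy hxy
    have h1 := hg.dist_le_mul x hx y hy
    have h2 : x - y = g y - g x := by
      have : x + g x = y + g y := hxy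
      rw [sub_eq_sub_iff_add_eq_add, this, add_comm]
    rw [dist_eq_norm (g x), norm_sub_rev, ← h2, ← dist_eq_norm] at h1
    by_contra hne
    have h3 := dist_pos.2 hne
    nlinarith
  · intro y hy
    let k : E → E := fun x => if ‖x‖ ≤ 1 then g x else 0
    have hmixed : ∀ a b : E, ‖a‖ ≤ 1 → ¬ ‖b‖ ≤ 1 → dist (g a) 0 ≤ L * dist a b := by
      intro a b ha hb
      obtain ⟨z, hz, hd⟩ := exists_mem_segment_norm_eq ha (not_le.1 hb).le
      rw [← hg0 z (by simpa using hz)]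
      exact (hg.dist_le_mul a (by simpa using ha) z (by simp [hz])).trans
        (mul_le_mul_of_nonneg_left hd L.2)
    have hk : LipschitzWith L k := by
      refine LipschitzWith.of_dist_le_mul fun a b => ?_
      by_cases ha : ‖a‖ ≤ 1 <;> by_cases hb : ‖b‖ ≤ 1
      · simp only [k, if_pos ha, if_pos hb]
        exact hg.dist_le_mul a (by simpa using ha) b (by simpa using hb)
      · simp only [k, if_pos ha, if_neg hb]
        exact hmixed a b ha hb
      · simp only [k, if_neg ha, if_pos hb]
        rw [dist_comm, dist_comm a b]
        exact hmixed b a hb ha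
      · simp only [k, if_neg ha, if_neg hb, dist_self]
        positivity
    have hcon : ContractingWith L fun x => y - k x := by
      refine ⟨hL, LipschitzWith.of_dist_le_mul fun a b => ?_⟩
      rw [dist_sub_left]
      exact hk.dist_le_mul a b
    have hfix : y - k hcon.fixedPoint = hcon.fixedPoint := hcon.fixedPoint_isFixedPt
    set x := hcon.fixedPoint
    by_cases hx : ‖x‖ ≤ 1
    · refine ⟨x, by simpa using hx, ?_⟩
      simp only [k, if_pos hx] at hfix
      exact (sub_eq_iff_eq_add.1 hfix).symm
    · simp only [k, if_neg hx, sub_zero] at hfix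
      exact absurd (by simpa [hfix] using hy) hx

lemma det_fderiv_eq_zero_of_norm_eq_one {h : E → E} {h' : E →L[ℝ] E} {x : E}
    (hh : HasFDerivAt h h' x) (hn : ∀ᶠ y in nhds x, ‖h y‖ = 1) : h'.det = 0 := by
  by_contra hdet
  have hsurj : Function.Surjective h' := by
    intro y
    exact ⟨(LinearMap.equivOfDetNeZero (h' : E →ₗ[ℝ] E) hdet).symm y,
      (LinearMap.equivOfDetNeZero (h' : E →ₗ[ℝ] E) hdet).apply_symm_apply y⟩
  have h1 := hh.norm_sq
  have h2 : HasFDerivAt (fun y => ‖h y‖ ^ 2) (0 : E →L[ℝ] ℝ) x := by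
    refine (hasFDerivAt_const (1 : ℝ) x).congr_of_eventuallyEq ?_
    filter_upwards [hn] with y hy
    simp [hy]
  have h3 := h1.unique h2
  obtain ⟨v, hv⟩ := hsurj (h x)
  have h4 := congrArg (fun l => l v) h3
  have h5 := hn.self_of_nhds
  simp [hv, h5] at h4

variable [MeasurableSpace E] [BorelSpace E]

/-- There is no `C¹` retraction of the closed unit ball onto the unit sphere. -/
theorem not_exists_contDiff_retraction {h : E → E}
    (hd : ∀ x ∈ closedBall (0 : E) 1, ContDiffAt ℝ 1 h x)
    (hn : ∀ x ∈ closedBall (0 : E) 1, ‖h x‖ = 1) (hs : ∀ x ∈ sphere (0 : E) 1, h x = x) :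
    False := by
  let g : E → E := fun x => h x - x
  let A : E → E →L[ℝ] E := fderiv ℝ g
  let B : Set E := closedBall 0 1
  have hgd : ∀ x ∈ B, ContDiffAt ℝ 1 g x := fun x hx => (hd x hx).sub contDiffAt_id
  have hgA : ∀ x ∈ B, HasFDerivAt g (A x) x := fun x hx =>
    ((hgd x hx).differentiableAt one_ne_zero).hasFDerivAt
  have hAc : ContinuousOn A B := fun x hx =>
    ((hgd x hx).fderiv_right (m := 0) (by simp)).continuousAt.continuousWithinAt
  have hBc : IsCompact B := isCompact_closedBall 0 1
  obtain ⟨K, hK⟩ := hBc.exists_bound_of_continuousOn hAc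
  let L : NNReal := K.toNNReal + 1
  have hLpos : (0 : ℝ) < L := by positivity
  have hKL : ∀ x ∈ B, ‖A x‖ ≤ L := fun x hx => (hK x hx).trans (by
    simp only [L, NNReal.coe_add, NNReal.coe_one]; linarith [Real.le_coe_toNNReal K])
  have hgL : LipschitzOnWith L g B :=
    (convex_closedBall 0 1).lipschitzOnWith_of_nnnorm_hasFDerivWithin_le
      (fun x hx => (hgA x hx).hasFDerivWithinAt) (fun x hx => hKL x hx)
  have hint : ∀ t : ℝ, IntegrableOn
      (fun x => (ContinuousLinearMap.id ℝ E + t • A x).det) B := by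
    intro t
    refine ContinuousOn.integrableOn_compact hBc ?_
    exact ContinuousLinearMap.continuous_det.comp_continuousOn
      (continuousOn_const.add (hAc.const_smul t))
  have hvol : ∀ t ∈ Ioo (0 : ℝ) (min 1 (1 / L)),
      ∫ x in B, (ContinuousLinearMap.id ℝ E + t • A x).det = volume.real B := by
    intro t ht
    have ht0 : 0 < t := ht.1
    have ht1 : t < 1 := ht.2.trans_le (min_le_left _ _)
    have htL : t * L < 1 := by
      have := ht.2.trans_le (min_le_right _ _)
      rwa [lt_div_iff₀ hLpos] at this
    have hlip : LipschitzOnWith (t.toNNReal * L) (fun x => t • g x) B := by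
      refine LipschitzOnWith.of_dist_le_mul fun x hx y hy => ?_
      rw [dist_smul₀, Real.norm_of_nonneg ht0.le, NNReal.coe_mul, Real.coe_toNNReal _ ht0.le,
        mul_assoc]
      exact mul_le_mul_of_nonneg_left (hgL.dist_le_mul x hx y hy) ht0.le
    obtain ⟨hinj, hsub⟩ := image_closedBall_id_add (g := fun x => t • g x)
      (L := t.toNNReal * L) (by
        rw [← NNReal.coe_lt_coe, NNReal.coe_mul, Real.coe_toNNReal _ ht0.le]; exact_mod_cast htL)
      hlip (fun x hx => by simp [g, hs x hx])
    have himg : (fun x => x + t • g x) '' B = B := by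
      refine Subset.antisymm ?_ hsub
      rintro _ ⟨x, hx, rfl⟩
      have h1 : ‖x‖ ≤ 1 := by simpa [B] using hx
      have h2 : x + t • g x = (1 - t) • x + t • h x := by
        simp only [g]; module
      have : ‖(1 - t) • x + t • h x‖ ≤ 1 := by
        refine (norm_add_le _ _).trans ?_
        rw [norm_smul, norm_smul, hn x hx, Real.norm_of_nonneg ht0.le,
          Real.norm_of_nonneg (by linarith)]
        nlinarith
      simpa [B, h2] using this
    have hcv := integral_image_eq_integral_abs_det_fderiv_smul (volume : Measure E)
      (f := fun x => x + t • g x) (s := B)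
      (f' := fun x => ContinuousLinearMap.id ℝ E + t • A x)
      hBc.measurableSet (fun x hx => ((hasFDerivAt_id x).add
        ((hgA x hx).const_smul t)).hasFDerivWithinAt) hinj (fun _ => (1 : ℝ))
    rw [himg] at hcv
    simp only [smul_eq_mul, mul_one, integral_const, MeasurableSet.univ, measureReal_restrict_apply,
      univ_inter] at hcv
    rw [hcv]
    refine setIntegral_congr_fun hBc.measurableSet fun x hx => ?_
    refine (abs_of_pos (det_id_add_smul_pos (A x) ht0.le ?_)).symm
    exact (mul_le_mul_of_nonneg_left (hKL x hx) ht0.le).trans_lt htL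
  -- interpolate at `finrank + 1` nodes
  have hδ : (0 : ℝ) < min 1 (1 / L) := lt_min one_pos (one_div_pos.2 hLpos)
  obtain ⟨s, hsub, hcard⟩ := (Ioo_infinite hδ).exists_subset_card_eq (Module.finrank ℝ E + 1)
  have hinjs : Set.InjOn (id : ℝ → ℝ) s := injOn_id _
  have hinterp : ∀ p : ℝ[X], p.natDegree ≤ Module.finrank ℝ E →
      p.eval 1 = ∑ i ∈ s, p.eval i * (Lagrange.basis s id i).eval 1 := by
    intro p hp
    have := Lagrange.eq_interpolate (f := p) hinjs (by
      rw [hcard]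
      exact (degree_le_natDegree).trans_lt (by exact_mod_cast Nat.lt_succ_of_le hp))
    conv_lhs => rw [this]
    simp [Lagrange.interpolate_apply, eval_finsetSum]
  have hone := hinterp 1 (by simp)
  simp only [eval_one, one_mul] at hone
  have hdet1 : ∀ x ∈ B, (ContinuousLinearMap.id ℝ E + (1 : ℝ) • A x).det =
      ∑ i ∈ s, (ContinuousLinearMap.id ℝ E + i • A x).det * (Lagrange.basis s id i).eval 1 := by
    intro x _
    obtain ⟨p, hp, hpe⟩ := exists_polynomial_det_one_add_smul (A x)
    simp only [hpe]
    exact hinterp p hp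
  have hfin : ∫ x in B, (ContinuousLinearMap.id ℝ E + (1 : ℝ) • A x).det = volume.real B := by
    rw [setIntegral_congr_fun hBc.measurableSet hdet1,
      integral_finsetSum _ fun i _ => (hint i).mul_const _]
    simp only [integral_mul_const]
    rw [Finset.sum_congr rfl fun i hi => by rw [hvol i (hsub hi)], ← Finset.mul_sum, ← hone,
      mul_one]
  have hball : ∫ x in B, (ContinuousLinearMap.id ℝ E + (1 : ℝ) • A x).det = 0 := by
    have hBo : (B : Set E) =ᵐ[volume] ball (0 : E) 1 := by
      rw [ae_eq_set]
      refine ⟨measure_mono_null ?_ (Measure.addHaar_sphere_of_ne_zero volume (0 : E) one_ne_zero),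
        by rw [sdiff_eq_empty.2 ball_subset_closedBall]; exact measure_empty⟩
      intro x hx
      simp only [B, mem_sdiff, mem_closedBall, mem_ball, not_lt] at hx
      exact le_antisymm hx.1 hx.2
    rw [setIntegral_congr_set hBo]
    refine setIntegral_eq_zero_of_forall_eq_zero fun x hx => ?_
    refine det_fderiv_eq_zero_of_norm_eq_one (h := h) (x := x) ?_ ?_
    · have := (hgA x (ball_subset_closedBall hx)).add (hasFDerivAt_id x)
      convert this using 1
      · ext y; simp [g]
      · rw [one_smul, add_comm]
    · filter_upwards [isOpen_ball.mem_nhds hx] with y hy using hn y (ball_subset_closedBall hy)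
  rw [hball] at hfin
  have hpos : 0 < volume.real B := by
    refine ENNReal.toReal_pos (measure_closedBall_pos _ _ one_pos).ne' hBc.measure_lt_top.ne
  exact hpos.ne hfin

end Retraction

section FixedPoint

open Metric Set

variable {E : Type*} [NormedAddCommGroup E] [InnerProductSpace ℝ E] [FiniteDimensional ℝ E]

/-- A `C¹` map into the open unit ball has a fixed point in the closed unit ball. -/
lemma exists_fixedPoint_of_contDiff {p : E → E} (hp : ContDiff ℝ 1 p) (hp1 : ∀ x, ‖p x‖ < 1) :
    ∃ x ∈ closedBall (0 : E) 1, p x = x := by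
  by_contra! hne
  borelize E
  let w : E → E := fun x => x - p x
  let D : E → ℝ := fun x => ⟪x, w x⟫ ^ 2 + ‖w x‖ ^ 2 * (1 - ‖x‖ ^ 2)
  let l : E → ℝ := fun x => (-⟪x, w x⟫ + Real.sqrt (D x)) / ‖w x‖ ^ 2
  have hw : ∀ x ∈ closedBall (0 : E) 1, 0 < ‖w x‖ ^ 2 := fun x hx =>
    pow_pos (norm_pos_iff.2 (sub_ne_zero.2 (hne x hx).symm)) 2
  have hsph : ∀ x ∈ sphere (0 : E) 1, 0 < ⟪x, w x⟫ := by
    intro x hx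
    have hx1 : ‖x‖ = 1 := by simpa using hx
    have h1 : ⟪x, p x⟫ ≤ ‖x‖ * ‖p x‖ := real_inner_le_norm _ _
    simp only [w, inner_sub_right, real_inner_self_eq_norm_sq, hx1] at *
    linarith [hp1 x]
  have hD : ∀ x ∈ closedBall (0 : E) 1, 0 < D x := by
    intro x hx
    have hx1 : ‖x‖ ≤ 1 := by simpa using hx
    rcases hx1.lt_or_eq with h | h
    · have : 0 < 1 - ‖x‖ ^ 2 := by nlinarith [norm_nonneg x]
      have := mul_pos (hw x hx) this
      simp only [D]; positivity
    · have := pow_pos (hsph x (by simpa using h)) 2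
      simp only [D, h]; simpa using this
  have hwd : ContDiff ℝ 1 w := contDiff_id.sub hp
  have hin : ContDiff ℝ 1 fun x => ⟪x, w x⟫ := contDiff_id.inner ℝ hwd
  have hDd : ContDiff ℝ 1 D :=
    (hin.pow 2).add ((hwd.norm_sq ℝ).mul (contDiff_const.sub (contDiff_norm_sq ℝ)))
  refine not_exists_contDiff_retraction (h := fun x => x + l x • w x) ?_ ?_ ?_
  · intro x hx
    have hl : ContDiffAt ℝ 1 l x :=
      ((hin.contDiffAt.neg).add (hDd.contDiffAt.sqrt (hD x hx).ne')).div
        (hwd.norm_sq ℝ).contDiffAt (hw x hx).ne'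
    exact contDiffAt_id.add (hl.smul hwd.contDiffAt)
  · intro x hx
    have h1 : l x * ‖w x‖ ^ 2 = -⟪x, w x⟫ + Real.sqrt (D x) := div_mul_cancel₀ _ (hw x hx).ne'
    have h2 : Real.sqrt (D x) ^ 2 = D x := Real.sq_sqrt (hD x hx).le
    have h3 : ‖x + l x • w x‖ ^ 2 = 1 := by
      rw [norm_add_sq_real, norm_smul, inner_smul_right, mul_pow, Real.norm_eq_abs, sq_abs]
      have h4 : Real.sqrt (D x) = l x * ‖w x‖ ^ 2 + ⟪x, w x⟫ := by linarith
      rw [h4] at h2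
      simp only [D] at h2
      have h5 : ‖w x‖ ^ 2 * (‖x‖ ^ 2 + 2 * (l x * ⟪x, w x⟫) + l x ^ 2 * ‖w x‖ ^ 2) =
        ‖w x‖ ^ 2 * 1 := by linear_combination h2
      exact mul_left_cancel₀ (hw x hx).ne' h5
    exact (sq_eq_sq₀ (norm_nonneg _) zero_le_one).1 (by rw [h3, one_pow])
  · intro x hx
    have hx1 : ‖x‖ = 1 := by simpa using hx
    have : l x = 0 := by
      simp only [l, D, hx1]
      simp [Real.sqrt_sq (hsph x hx).le]
    simp [this]

/-- **Brouwer's fixed point theorem**, for continuous maps of a Euclidean space into its closed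
unit ball. -/
theorem exists_fixedPoint_of_norm_le_one {f : E → E} (hf : Continuous f)
    (hf1 : ∀ x, ‖f x‖ ≤ 1) : ∃ x, f x = x := by
  by_contra! hne
  obtain ⟨x₀, hx₀, hmin⟩ := (isCompact_closedBall (0 : E) 1).exists_isMinOn
    ⟨0, by simp⟩ ((hf.sub continuous_id).norm.continuousOn)
  set δ := ‖f x₀ - x₀‖ with hδ
  have hδ0 : 0 < δ := norm_pos_iff.2 (sub_ne_zero.2 (hne x₀))
  obtain ⟨g, hg, hgf, -⟩ := hf.exists_contDiff_approx 1 (ε := fun _ => δ / 4) continuous_const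
    (fun _ => by positivity)
  have hg1 : ∀ x, ‖g x‖ < 1 + δ / 4 := fun x => by
    have h1 := hgf x
    rw [dist_eq_norm] at h1
    have h2 := norm_le_norm_add_norm_sub' (g x) (f x)
    linarith [hf1 x]
  have hc : 0 < 1 + δ / 4 := by positivity
  obtain ⟨x, hx, hfix⟩ := exists_fixedPoint_of_contDiff
    (p := fun x => (1 + δ / 4)⁻¹ • g x) (contDiff_const.smul hg) (fun x => by
      rw [norm_smul, norm_inv, Real.norm_of_nonneg hc.le, inv_mul_lt_iff₀ hc, mul_one]
      exact hg1 x)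
  have h1 : g x = x + (δ / 4) • x := by
    rw [inv_smul_eq_iff₀ hc.ne', add_smul, one_smul] at hfix
    exact hfix
  have hx1 : ‖x‖ ≤ 1 := by simpa using hx
  have h2 := hgf x
  rw [dist_eq_norm, norm_sub_rev] at h2
  have h3 : ‖f x - x‖ ≤ ‖f x - g x‖ + ‖(δ / 4) • x‖ := by
    calc ‖f x - x‖ = ‖(f x - g x) + (δ / 4) • x‖ := by rw [h1]; congr 1; abel
      _ ≤ _ := norm_add_le _ _
  rw [norm_smul, Real.norm_of_nonneg (by positivity)] at h3
  have h4 : δ ≤ ‖f x - x‖ := hmin hx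
  nlinarith

/-- **Brouwer's fixed point theorem** on the standard simplex. -/
theorem exists_fixedPoint_stdSimplex {ι : Type*} [Fintype ι] [Nonempty ι]
    {f : (ι → ℝ) → ι → ℝ} (hf : ContinuousOn f (stdSimplex ℝ ι))
    (hmaps : MapsTo f (stdSimplex ℝ ι) (stdSimplex ℝ ι)) : ∃ x ∈ stdSimplex ℝ ι, f x = x := by
  -- a retraction of `ℝ^ι` onto the simplex
  let S : (ι → ℝ) → ℝ := fun x => ∑ i, max (x i) 0
  let N : ℝ := Fintype.card ι
  have hN : 0 < N := by simp only [N]; exact_mod_cast Fintype.card_pos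
  let r : (ι → ℝ) → ι → ℝ := fun x i => (max (x i) 0 + max (1 - S x) 0 / N) / max (S x) 1
  have hS : Continuous S := by fun_prop
  have hpos : ∀ x, 0 < max (S x) 1 := fun x => lt_max_of_lt_right one_pos
  have hr : Continuous r := by
    refine continuous_pi fun i => Continuous.div (by fun_prop) (by fun_prop) fun x => (hpos x).ne'
  have hrmem : ∀ x, r x ∈ stdSimplex ℝ ι := by
    intro x
    refine ⟨fun i => by positivity, ?_⟩
    simp only [r]
    rw [← Finset.sum_div, div_eq_one_iff_eq (hpos x).ne', Finset.sum_add_distrib]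
    simp only [Finset.sum_const, Finset.card_univ, nsmul_eq_mul]
    rw [mul_div_cancel₀ _ hN.ne']
    change S x + max (1 - S x) 0 = max (S x) 1
    rcases le_total (S x) 1 with h | h
    · rw [max_eq_left (by linarith), max_eq_right h]; ring
    · rw [max_eq_right (by linarith), max_eq_left h]; ring
  have hrid : ∀ x ∈ stdSimplex ℝ ι, r x = x := by
    intro x hx
    have h1 : S x = 1 := by
      rw [← hx.2]; exact Finset.sum_congr rfl fun i _ => max_eq_left (hx.1 i)
    ext i
    simp [r, h1, max_eq_left (hx.1 i)]
  let e := EuclideanSpace.equiv ι ℝ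
  obtain ⟨x, hx⟩ := exists_fixedPoint_of_norm_le_one
    (f := fun x : EuclideanSpace ℝ ι => e.symm (f (r (e x))))
    (e.symm.continuous.comp ((hf.comp_continuous hr hrmem).comp e.continuous)) (by
      intro x
      have hm := hmaps (hrmem (e x))
      rw [EuclideanSpace.norm_eq, Real.sqrt_le_one]
      calc ∑ i, ‖f (r (e x)) i‖ ^ 2 ≤ ∑ i, f (r (e x)) i := by
            refine Finset.sum_le_sum fun i _ => ?_
            rw [Real.norm_of_nonneg (hm.1 i), sq]
            have hle : f (r (e x)) i ≤ 1 := by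
              rw [← hm.2]
              exact Finset.single_le_sum (fun j _ => hm.1 j) (Finset.mem_univ i)
            exact mul_le_of_le_one_left (hm.1 i) hle
        _ = 1 := hm.2)
  have hx' : f (r (e x)) = e x := by
    exact e.symm.injective (by rw [hx]; simp)
  have hmem : e x ∈ stdSimplex ℝ ι := hx' ▸ hmaps (hrmem _)
  rw [hrid _ hmem] at hx'
  exact ⟨e x, hmem, hx'⟩

/-- **The Schauder–Tychonoff fixed point theorem.** -/
theorem IsCompact.exists_fixedPoint_of_convex {X : Type*} [AddCommGroup X] [Module ℝ X]
    [TopologicalSpace X] [IsTopologicalAddGroup X] [ContinuousSMul ℝ X] [LocallyConvexSpace ℝ X]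
    [T2Space X] {K : Set X} (hK : IsCompact K) (hKc : Convex ℝ K) (hne : K.Nonempty)
    {f : X → X} (hf : ContinuousOn f K) (hmaps : MapsTo f K K) : ∃ x ∈ K, f x = x := by
  have happrox : ∀ V : Set X, (0 : X) ∈ V → IsOpen V → Convex ℝ V → ∃ x ∈ K, f x - x ∈ V := by
    intro V h0 hVo hVc
    obtain ⟨s, hsK, hcov⟩ := hK.elim_nhds_subcover (fun y => {z | z - y ∈ V}) (fun y _ =>
      (hVo.preimage (by fun_prop : Continuous fun z : X => z - y)).mem_nhds (by simpa using h0))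
    have hgauge : Continuous (gauge V) := continuous_gauge hVc (hVo.mem_nhds h0)
    let wt : X → s → ℝ := fun z y => max (1 - gauge V (z - y)) 0
    let S : X → ℝ := fun z => ∑ y, wt z y
    have hwt : ∀ y, Continuous fun z => wt z y := fun y => by fun_prop
    have hS : Continuous S := continuous_finsetSum _ fun y _ => hwt y
    have hwt0 : ∀ z y, 0 ≤ wt z y := fun z y => le_max_right _ _
    have hSpos : ∀ z ∈ K, 0 < S z := by
      intro z hz
      obtain ⟨y, hy, hzy⟩ := mem_iUnion₂.1 (hcov hz)
      have h1 : gauge V (z - y) < 1 := gauge_lt_one_of_mem_of_isOpen hVo hzy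
      exact Finset.sum_pos' (fun y _ => hwt0 z y)
        ⟨⟨y, hy⟩, Finset.mem_univ _, lt_max_of_lt_left (by linarith)⟩
    have hmemV : ∀ z y, wt z y ≠ 0 → z - y ∈ V := by
      intro z y h
      by_contra hnot
      have h1 : ¬ gauge V (z - y) < 1 := fun h2 =>
        hnot (setOfPred_gauge_lt_one_subset_self hVc h0
          (absorbent_nhds_zero (hVo.mem_nhds h0)) h2)
      exact h (max_eq_right (by linarith))
    let W : X → s → ℝ := fun z y => wt z y / S z
    have hW : ∀ z ∈ K, W z ∈ stdSimplex ℝ s := fun z hz =>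
      ⟨fun y => div_nonneg (hwt0 z y) (hSpos z hz).le, by
        simp only [W]; rw [← Finset.sum_div]; exact div_self (hSpos z hz).ne'⟩
    have hWc : ContinuousOn W K := continuousOn_pi.2 fun y =>
      (hwt y).continuousOn.div hS.continuousOn fun z hz => (hSpos z hz).ne'
    let c : (s → ℝ) → X := fun l => ∑ y, l y • (y : X)
    have hc : Continuous c := by fun_prop
    have hcK : MapsTo c (stdSimplex ℝ s) K := fun l hl =>
      hKc.sum_mem (fun y _ => hl.1 y) hl.2 fun y _ => hsK y y.2
    have : Nonempty s := by
      obtain ⟨z, hz⟩ := hne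
      obtain ⟨y, hy, -⟩ := mem_iUnion₂.1 (hcov hz)
      exact ⟨⟨y, hy⟩⟩
    obtain ⟨l, hl, hfix⟩ := exists_fixedPoint_stdSimplex (f := fun l => W (f (c l)))
      (hWc.comp (hf.comp hc.continuousOn hcK) (hmaps.comp hcK)) fun l hl => hW _ (hmaps (hcK hl))
    refine ⟨c l, hcK hl, ?_⟩
    have h1 : f (c l) - c l = ∑ y, l y • (f (c l) - (y : X)) := by
      simp only [smul_sub, Finset.sum_sub_distrib]
      rw [← Finset.sum_smul, hl.2, one_smul]
    rw [h1]
    rw [← finsum_eq_sum_of_fintype]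
    refine hVc.finsum_mem hl.1 (by rw [finsum_eq_sum_of_fintype]; exact hl.2) fun y hy => ?_
    refine hmemV _ _ fun h => hy ?_
    rw [← hfix]
    simp [W, h]
  by_contra! hno
  have himg : IsClosed ((fun x => f x - x) '' K) :=
    (hK.image_of_continuousOn (hf.sub continuousOn_id)).isClosed
  have h0 : (0 : X) ∉ (fun x => f x - x) '' K := by
    rintro ⟨x, hx, h⟩
    exact hno x hx (sub_eq_zero.1 h)
  obtain ⟨V, ⟨hV0, hVo, hVc⟩, hV⟩ := (LocallyConvexSpace.convex_open_basis_zero ℝ X).mem_iff.1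
    (himg.isOpen_compl.mem_nhds h0)
  obtain ⟨x, hx, hxV⟩ := happrox V hV0 hVo hVc
  exact hV hxV ⟨x, hx, rfl⟩

end FixedPoint

section Control

open Set Filter Topology

/-- Convex functions bounded below by `-c` and above by `c * (1 + ‖x‖ ^ 2)`. -/
def QuadBdd {E : Type*} [NormedAddCommGroup E] [Module ℝ E] (c : ℝ) (v : E → ℝ) : Prop :=
  ConvexOn ℝ univ v ∧ ∀ x, -c ≤ v x ∧ v x ≤ c * (1 + ‖x‖ ^ 2)

lemma norm_add_sq_le_two {E : Type*} [SeminormedAddCommGroup E] (x y : E) :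
    ‖x + y‖ ^ 2 ≤ 2 * ‖x‖ ^ 2 + 2 * ‖y‖ ^ 2 := by
  have h1 := norm_add_le x y
  have h2 := norm_nonneg (x + y)
  nlinarith [sq_nonneg (‖x‖ - ‖y‖)]

variable {E : Type*} [NormedAddCommGroup E] [InnerProductSpace ℝ E]

/-- The cost `a ↦ ½‖a‖² + ⟪a, P⟫ + f + G (x + a)`. -/
noncomputable def quadCost (P : E) (f : ℝ) (G : E → ℝ) (x a : E) : ℝ :=
  (1 / 2) * ‖a‖ ^ 2 + ⟪a, P⟫ + f + G (x + a)

lemma norm_combo_sq {s t : ℝ} (hst : s + t = 1) (a b : E) :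
    ‖s • a + t • b‖ ^ 2 = s * ‖a‖ ^ 2 + t * ‖b‖ ^ 2 - s * t * ‖a - b‖ ^ 2 := by
  rw [norm_add_sq_real, norm_sub_sq_real, norm_smul, norm_smul, inner_smul_left, inner_smul_right,
    mul_pow, mul_pow, Real.norm_eq_abs, Real.norm_eq_abs, sq_abs, sq_abs]
  obtain rfl : t = 1 - s := by linarith
  simp only [conj_trivial]
  ring

lemma quadCost_combo_le {P : E} {f f₁ f₂ : ℝ} {G : E → ℝ} (hG : ConvexOn ℝ univ G) {s t : ℝ}
    (hs : 0 ≤ s) (ht : 0 ≤ t) (hst : s + t = 1) (x y a b : E) (hf : f ≤ s * f₁ + t * f₂) :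
    quadCost P f G (s • x + t • y) (s • a + t • b) ≤
      s * quadCost P f₁ G x a + t * quadCost P f₂ G y b - s * t / 2 * ‖a - b‖ ^ 2 := by
  have h1 := hG.2 (mem_univ (x + a)) (mem_univ (y + b)) hs ht hst
  have h2 : s • x + t • y + (s • a + t • b) = s • (x + a) + t • (y + b) := by module
  simp only [quadCost, h2, norm_combo_sq hst, inner_add_left, inner_smul_left, conj_trivial,
    smul_eq_mul] at *
  nlinarith

/-- Quadratic growth of the cost around a minimizer. -/
lemma quadCost_add_le_of_isMin {P : E} {f : ℝ} {G : E → ℝ} (hG : ConvexOn ℝ univ G) {x a₀ : E}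
    (ha₀ : ∀ a, quadCost P f G x a₀ ≤ quadCost P f G x a) (a : E) :
    quadCost P f G x a₀ + 1 / 2 * ‖a - a₀‖ ^ 2 ≤ quadCost P f G x a := by
  have key : ∀ s : ℝ, 0 < s → s < 1 →
      quadCost P f G x a₀ + (1 - s) / 2 * ‖a - a₀‖ ^ 2 ≤ quadCost P f G x a := by
    intro s hs hs1
    have h1 := quadCost_combo_le (P := P) hG hs.le (sub_nonneg.2 hs1.le) (by ring) x x a a₀
      (f := f) (f₁ := f) (f₂ := f) (by linarith)
    have h2 : s • x + (1 - s) • x = x := by module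
    rw [h2] at h1
    have h3 := ha₀ (s • a + (1 - s) • a₀)
    have h4 : s * (quadCost P f G x a₀ + (1 - s) / 2 * ‖a - a₀‖ ^ 2) ≤
        s * quadCost P f G x a := by linarith
    exact le_of_mul_le_mul_left h4 hs
  have hlim : Tendsto (fun s : ℝ => quadCost P f G x a₀ + (1 - s) / 2 * ‖a - a₀‖ ^ 2)
      (𝓝[>] 0) (𝓝 (quadCost P f G x a₀ + (1 - 0) / 2 * ‖a - a₀‖ ^ 2)) := by
    refine Tendsto.mono_left (Continuous.tendsto (by fun_prop) 0) nhdsWithin_le_nhds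
  have := le_of_tendsto hlim (by
    filter_upwards [Ioo_mem_nhdsGT (one_pos : (0 : ℝ) < 1)] with s hs using key s hs.1 hs.2)
  simpa using this

lemma eq_of_quadCost_isMin {P : E} {f : ℝ} {G : E → ℝ} (hG : ConvexOn ℝ univ G) {x a b : E}
    (ha : ∀ a', quadCost P f G x a ≤ quadCost P f G x a')
    (hb : ∀ a', quadCost P f G x b ≤ quadCost P f G x a') : b = a := by
  have h1 := quadCost_add_le_of_isMin hG ha b
  have h2 := hb a
  have h3 : ‖b - a‖ ^ 2 ≤ 0 := by linarith
  exact sub_eq_zero.1 (norm_eq_zero.1 (pow_eq_zero_iff two_ne_zero |>.1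
    (le_antisymm h3 (sq_nonneg _))))

/-- Minimizers depend on the state in a nonexpansive way. -/
lemma norm_argmin_sub_le {P : E} {f g : ℝ} {G : E → ℝ} (hG : ConvexOn ℝ univ G) {x y p q : E}
    (hp : ∀ a, quadCost P f G x p ≤ quadCost P f G x a)
    (hq : ∀ a, quadCost P g G y q ≤ quadCost P g G y a) : ‖p - q‖ ≤ ‖x - y‖ := by
  have h1 := quadCost_add_le_of_isMin hG hp (q - (x - y))
  have h2 := quadCost_add_le_of_isMin hG hq (p + (x - y))
  have e1 : x + (q - (x - y)) = y + q := by abel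
  have e2 : y + (p + (x - y)) = x + p := by abel
  have e3 : q - (x - y) - p = -((p - q) + (x - y)) := by abel
  have e4 : p + (x - y) - q = (p - q) + (x - y) := by abel
  simp only [quadCost, e1, e2, e3, e4, norm_neg, inner_add_left, inner_sub_left (𝕜 := ℝ),
    norm_sub_sq_real q, norm_add_sq_real] at h1 h2
  have h3 : ‖p - q‖ ^ 2 ≤ -⟪p - q, x - y⟫ := by
    simp only [inner_sub_left, inner_sub_right] at *
    linarith
  have h4 : -⟪p - q, x - y⟫ ≤ ‖p - q‖ * ‖x - y‖ :=
    (neg_le_abs _).trans (abs_real_inner_le_norm _ _)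
  by_contra! hlt
  nlinarith [norm_nonneg (x - y)]

lemma le_quadCost {P : E} {f c C : ℝ} {G : E → ℝ} (hG : QuadBdd c G) (hP : ‖P‖ ≤ C) (x a : E) :
    1 / 2 * ‖a‖ ^ 2 - C * ‖a‖ + f - c ≤ quadCost P f G x a := by
  have h1 := (neg_le_abs _).trans (abs_real_inner_le_norm a P)
  have h2 := mul_le_mul_of_nonneg_left hP (norm_nonneg a)
  have h3 := (hG.2 (x + a)).1
  simp only [quadCost]
  linarith

lemma exists_isMin_quadCost [FiniteDimensional ℝ E] {P : E} {f c : ℝ} {G : E → ℝ}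
    (hG : QuadBdd c G) (x : E) : ∃ a, ∀ a', quadCost P f G x a ≤ quadCost P f G x a' := by
  have hGc : Continuous G := hG.1.locallyLipschitz.continuous
  have hc : Continuous (quadCost P f G x) := by unfold quadCost; fun_prop
  refine hc.exists_forall_le ?_
  refine tendsto_atTop_mono (fun a => le_quadCost hG le_rfl x a) ?_
  have h1 : Tendsto (fun r : ℝ => 1 / 2 * r ^ 2 - ‖P‖ * r + f - c) atTop atTop := by
    have : (fun r : ℝ => 1 / 2 * r ^ 2 - ‖P‖ * r + f - c) =
        fun r => r * (1 / 2 * r + -‖P‖) + (f - c) := by ext r; ring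
    rw [this]
    refine tendsto_atTop_add_const_right _ _ (tendsto_id.atTop_mul_atTop₀ ?_)
    exact tendsto_atTop_add_const_right _ _ (tendsto_id.const_mul_atTop (by norm_num))
  exact h1.comp (tendsto_norm_cocompact_atTop)

/-- The growth constant of minimizers of `quadCost`. -/
def ctrlConst (C c : ℝ) : ℝ := 2 * (C + 2 * c + 1)

lemma norm_argmin_le {P : E} {f c C : ℝ} {G : E → ℝ} (hc : 0 ≤ c) (hG : QuadBdd c G)
    (hP : ‖P‖ ≤ C) {x a : E} (ha : ∀ a', quadCost P f G x a ≤ quadCost P f G x a') :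
    ‖a‖ ≤ ctrlConst C c * (1 + ‖x‖) := by
  have hC : 0 ≤ C := (norm_nonneg _).trans hP
  have h1 := le_quadCost (f := f) hG hP x a
  have h2 := ha 0
  have h3 := (hG.2 x).2
  simp only [quadCost, norm_zero, inner_zero_left, add_zero] at h2 h1
  have h4 : ‖a‖ ^ 2 ≤ 4 * (C ^ 2 + 2 * c + c * ‖x‖ ^ 2) := by nlinarith [sq_nonneg (‖a‖ / 2 - C)]
  have hx := norm_nonneg x
  have h5 : 4 * (C ^ 2 + 2 * c + c * ‖x‖ ^ 2) ≤ (ctrlConst C c * (1 + ‖x‖)) ^ 2 := by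
    have : C ^ 2 + 2 * c + c * ‖x‖ ^ 2 ≤ (C + 2 * c + 1) ^ 2 * (1 + ‖x‖ ^ 2) := by
      have : C ^ 2 + 2 * c ≤ (C + 2 * c + 1) ^ 2 := by nlinarith [mul_nonneg hC hc]
      nlinarith [sq_nonneg ‖x‖, sq_nonneg C]
    simp only [ctrlConst]
    nlinarith [mul_nonneg (sq_nonneg (C + 2 * c + 1)) hx]
  exact (sq_le_sq₀ (norm_nonneg _) (by unfold ctrlConst; positivity)).1 (h4.trans h5)

/-- The minimal cost is again convex with quadratic growth. -/
lemma quadBdd_iInf_quadCost [FiniteDimensional ℝ E] {P : E} {f G : E → ℝ} {c C : ℝ}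
    (hG : QuadBdd c G) (hf : QuadBdd C f) (hP : ‖P‖ ≤ C) :
    QuadBdd (C ^ 2 / 2 + C + c) fun x => ⨅ a, quadCost P (f x) G x a := by
  have hC : 0 ≤ C := (norm_nonneg _).trans hP
  have hbdd : ∀ x, BddBelow (range (quadCost P (f x) G x)) := fun x => by
    obtain ⟨a, ha⟩ := exists_isMin_quadCost (P := P) (f := f x) hG x
    exact ⟨_, by rintro _ ⟨a', rfl⟩; exact ha a'⟩
  refine ⟨⟨convex_univ, fun x _ y _ s t hs ht hst => ?_⟩, fun x => ⟨?_, ?_⟩⟩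
  · have hx : ∀ x, ∃ a, ⨅ a, quadCost P (f x) G x a = quadCost P (f x) G x a := fun x => by
      obtain ⟨a, ha⟩ := exists_isMin_quadCost (P := P) (f := f x) hG x
      exact ⟨a, le_antisymm (ciInf_le (hbdd x) a) (le_ciInf ha)⟩
    obtain ⟨a, ha⟩ := hx x
    obtain ⟨b, hb⟩ := hx y
    dsimp only
    rw [ha, hb]
    refine (ciInf_le (hbdd _) (s • a + t • b)).trans
      ((quadCost_combo_le hG.1 hs ht hst x y a b
        (hf.1.2 (mem_univ x) (mem_univ y) hs ht hst)).trans ?_)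
    have : 0 ≤ s * t / 2 * ‖a - b‖ ^ 2 := by positivity
    simp only [smul_eq_mul]
    linarith
  · refine le_ciInf fun a => ?_
    have h1 := le_quadCost (f := f x) hG hP x a
    have h2 := (hf.2 x).1
    nlinarith [sq_nonneg (‖a‖ - C)]
  · refine (ciInf_le (hbdd x) 0).trans ?_
    have h1 := (hf.2 x).2
    have h2 := (hG.2 x).2
    have h3 : 0 ≤ C ^ 2 / 2 * (1 + ‖x‖ ^ 2) := by positivity
    simp only [quadCost, norm_zero, inner_zero_left, add_zero]
    linarith

/-- The stability constant of the minimal cost. -/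
def stabConst (C c : ℝ) : ℝ := 3 + 6 * ctrlConst C c ^ 2

lemma abs_quadCost_sub_le {P P' : E} {f f' : ℝ} {G G' : E → ℝ} {c C ε : ℝ} {x a : E}
    (hε : 0 ≤ ε) (hP : ‖P - P'‖ ≤ ε) (hf : |f - f'| ≤ ε * (1 + ‖x‖ ^ 2))
    (hG : ∀ y, |G y - G' y| ≤ ε * (1 + ‖y‖ ^ 2)) (ha : ‖a‖ ≤ ctrlConst C c * (1 + ‖x‖)) :
    |quadCost P f G x a - quadCost P' f' G' x a| ≤ ε * stabConst C c * (1 + ‖x‖ ^ 2) := by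
  have h1 : |⟪a, P - P'⟫| ≤ ‖a‖ * ε :=
    (abs_real_inner_le_norm a _).trans (mul_le_mul_of_nonneg_left hP (norm_nonneg a))
  have h2 := hG (x + a)
  have h3 := norm_add_sq_le_two x a
  have h4 : ‖a‖ ^ 2 ≤ 2 * ctrlConst C c ^ 2 * (1 + ‖x‖ ^ 2) := by
    have := pow_le_pow_left₀ (norm_nonneg a) ha 2
    nlinarith [mul_nonneg (sq_nonneg (ctrlConst C c)) (sq_nonneg (1 - ‖x‖))]
  have h5 : quadCost P f G x a - quadCost P' f' G' x a =
      ⟪a, P - P'⟫ + (f - f') + (G (x + a) - G' (x + a)) := by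
    simp only [quadCost, inner_sub_right]; ring
  rw [h5]
  refine (abs_add_three _ _ _).trans ?_
  have h6 : ‖a‖ + (1 + ‖x‖ ^ 2) + (1 + ‖x + a‖ ^ 2) ≤ stabConst C c * (1 + ‖x‖ ^ 2) := by
    simp only [stabConst]
    nlinarith [sq_nonneg (‖a‖ - 1 / 2)]
  nlinarith [mul_le_mul_of_nonneg_left h6 hε]

lemma abs_iInf_quadCost_sub_le [FiniteDimensional ℝ E] {P P' : E} {f f' : ℝ} {G G' : E → ℝ}
    {c C ε : ℝ} {x : E} (hc : 0 ≤ c) (hGb : QuadBdd c G) (hGb' : QuadBdd c G') (hPb : ‖P‖ ≤ C)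
    (hPb' : ‖P'‖ ≤ C) (hε : 0 ≤ ε) (hP : ‖P - P'‖ ≤ ε) (hf : |f - f'| ≤ ε * (1 + ‖x‖ ^ 2))
    (hG : ∀ y, |G y - G' y| ≤ ε * (1 + ‖y‖ ^ 2)) :
    |(⨅ a, quadCost P f G x a) - ⨅ a, quadCost P' f' G' x a| ≤
      ε * stabConst C c * (1 + ‖x‖ ^ 2) := by
  obtain ⟨a, ha⟩ := exists_isMin_quadCost (P := P) (f := f) hGb x
  obtain ⟨b, hb⟩ := exists_isMin_quadCost (P := P') (f := f') hGb' x
  have ea : ⨅ a, quadCost P f G x a = quadCost P f G x a :=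
    le_antisymm (ciInf_le ⟨_, by rintro _ ⟨a', rfl⟩; exact ha a'⟩ a) (le_ciInf ha)
  have eb : ⨅ a, quadCost P' f' G' x a = quadCost P' f' G' x b :=
    le_antisymm (ciInf_le ⟨_, by rintro _ ⟨a', rfl⟩; exact hb a'⟩ b) (le_ciInf hb)
  have h1 := abs_le.1 (abs_quadCost_sub_le hε hP hf hG (norm_argmin_le hc hGb hPb ha))
  have h2 := abs_le.1 (abs_quadCost_sub_le hε hP hf hG (norm_argmin_le hc hGb' hPb' hb))
  rw [ea, eb, abs_le]
  constructor
  · linarith [hb a]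
  · linarith [ha b]

lemma norm_argmin_sub_sq_le {P P' : E} {f f' : ℝ} {G G' : E → ℝ}
    {c C ε : ℝ} {x a b : E} (hc : 0 ≤ c) (hGb : QuadBdd c G) (hGb' : QuadBdd c G')
    (hPb : ‖P‖ ≤ C) (hPb' : ‖P'‖ ≤ C) (hε : 0 ≤ ε) (hP : ‖P - P'‖ ≤ ε)
    (hf : |f - f'| ≤ ε * (1 + ‖x‖ ^ 2)) (hG : ∀ y, |G y - G' y| ≤ ε * (1 + ‖y‖ ^ 2))
    (ha : ∀ a', quadCost P f G x a ≤ quadCost P f G x a')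
    (hb : ∀ a', quadCost P' f' G' x b ≤ quadCost P' f' G' x a') :
    ‖b - a‖ ^ 2 ≤ 4 * (ε * stabConst C c * (1 + ‖x‖ ^ 2)) := by
  have h0 := quadCost_add_le_of_isMin hGb.1 ha b
  have h1 := abs_le.1 (abs_quadCost_sub_le hε hP hf hG (norm_argmin_le hc hGb hPb ha))
  have h2 := abs_le.1 (abs_quadCost_sub_le hε hP hf hG (norm_argmin_le hc hGb' hPb' hb))
  linarith [hb a]

end Control

section Risk

open Set Filter Topology

/-- `ξ` is a Borel probability measure with second moment at most `c`. -/
def SndMoment {X : Type*} [MeasurableSpace X] [NormedAddCommGroup X] (c : ℝ) (ξ : Measure X) :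
    Prop :=
  IsProbabilityMeasure ξ ∧ ∫⁻ x, (‖x‖₊ : ℝ≥0∞) ^ (2 : ℕ) ∂ξ ≤ ENNReal.ofReal c

namespace SndMoment

variable {X : Type*} [MeasurableSpace X] [NormedAddCommGroup X]
  {c : ℝ} {ξ : Measure X}

lemma mono (h : SndMoment c ξ) {c' : ℝ} (hc : c ≤ c') : SndMoment c' ξ :=
  ⟨h.1, h.2.trans (ENNReal.ofReal_le_ofReal hc)⟩

lemma lintegral_norm_sq (ξ : Measure X) :
    ∫⁻ x, (‖x‖₊ : ℝ≥0∞) ^ (2 : ℕ) ∂ξ = ∫⁻ x, ENNReal.ofReal (‖x‖ ^ 2) ∂ξ := by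
  congr with x
  rw [ENNReal.ofReal_pow (norm_nonneg x), ofReal_norm]
  rfl

lemma of_integral [IsProbabilityMeasure ξ] (hi : Integrable (fun x => ‖x‖ ^ 2) ξ)
    (h : ∫ x, ‖x‖ ^ 2 ∂ξ ≤ c) : SndMoment c ξ := by
  refine ⟨inferInstance, ?_⟩
  rw [lintegral_norm_sq, ← ofReal_integral_eq_lintegral_ofReal hi
    (Eventually.of_forall fun x => by positivity)]
  exact ENNReal.ofReal_le_ofReal h

variable [BorelSpace X]

lemma integrable_norm_sq (h : SndMoment c ξ) : Integrable (fun x => ‖x‖ ^ 2) ξ := by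
  refine ⟨by fun_prop, ?_⟩
  rw [hasFiniteIntegral_iff_ofReal (Eventually.of_forall fun x => by positivity),
    ← lintegral_norm_sq]
  exact h.2.trans_lt ENNReal.ofReal_lt_top

lemma integral_norm_sq_le (h : SndMoment c ξ) (hc : 0 ≤ c) : ∫ x, ‖x‖ ^ 2 ∂ξ ≤ c := by
  rw [integral_eq_lintegral_of_nonneg_ae (Eventually.of_forall fun x => by positivity)
    (by fun_prop), ← lintegral_norm_sq]
  exact ENNReal.toReal_le_of_le_ofReal hc h.2

/-- Functions of at most quadratic growth are integrable. -/
lemma integrable_of_le (h : SndMoment c ξ) {f : X → ℝ} (hf : AEStronglyMeasurable f ξ) (k : ℝ)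
    (hle : ∀ x, |f x| ≤ k * (1 + ‖x‖ ^ 2)) : Integrable f ξ := by
  have := h.1
  exact (((integrable_const (1 : ℝ)).add h.integrable_norm_sq).const_mul k).mono' hf
    (Eventually.of_forall fun x => by simpa using hle x)

lemma integral_le (h : SndMoment c ξ) (hc : 0 ≤ c) {f : X → ℝ} (hf : AEStronglyMeasurable f ξ)
    {k p q : ℝ} (hk : ∀ x, -k ≤ f x) (hq : 0 ≤ q) (hle : ∀ x, f x ≤ p + q * ‖x‖ ^ 2) :
    Integrable f ξ ∧ -k ≤ ∫ x, f x ∂ξ ∧ ∫ x, f x ∂ξ ≤ p + q * c := by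
  have := h.1
  have hi : Integrable f ξ := by
    refine h.integrable_of_le hf (|k| + |p| + q) fun x => abs_le.2 ⟨?_, ?_⟩
    · have h1 := hk x
      have h2 := le_abs_self k
      have h3 : (0 : ℝ) ≤ |p| + q := by positivity
      have h4 : 0 ≤ (|k| + |p| + q) * ‖x‖ ^ 2 := by positivity
      linarith
    · have h1 := hle x
      have h2 := le_abs_self p
      have h3 : (0 : ℝ) ≤ |k| := by positivity
      have h4 : 0 ≤ (|k| + |p|) * ‖x‖ ^ 2 := by positivity
      linarith
  refine ⟨hi, ?_, ?_⟩
  · simpa using integral_mono (integrable_const (-k)) hi hk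
  · have h1 := integral_mono hi ((integrable_const p).add (h.integrable_norm_sq.const_mul q)) hle
    have h2 : ∫ x, ((fun _ : X => p) + fun x : X => q * ‖x‖ ^ 2) x ∂ξ = p + q * ∫ x, ‖x‖ ^ 2 ∂ξ := by
      rw [integral_add' (integrable_const p) (h.integrable_norm_sq.const_mul q),
        integral_const_mul]
      simp
    rw [h2] at h1
    linarith [mul_le_mul_of_nonneg_left (h.integral_norm_sq_le hc) hq]

lemma integrable_norm (h : SndMoment c ξ) : Integrable (fun x => ‖x‖) ξ :=
  h.integrable_of_le (by fun_prop) 1 fun x => by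
    rw [abs_of_nonneg (norm_nonneg x)]
    nlinarith [sq_nonneg (‖x‖ - 1)]

lemma integrable_of_lipschitz (h : SndMoment c ξ) {f : X → ℝ}
    {K : NNReal} (hf : LipschitzWith K f) : Integrable f ξ := by
  have := h.1
  refine ((integrable_const |f 0|).add (h.integrable_norm.const_mul K)).mono'
    hf.continuous.aestronglyMeasurable (Eventually.of_forall fun x => ?_)
  have h1 := hf.dist_le_mul x 0
  rw [dist_zero_right, Real.dist_eq] at h1
  have h2 := abs_sub_abs_le_abs_sub (f x) (f 0)
  simp only [Pi.add_apply, Real.norm_eq_abs]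
  linarith

end SndMoment

variable {d : ℕ}

/-- The worst-case expectation `y ↦ sup_{ξ ∈ M} ∫ v (y + z) dξ(z)`. -/
noncomputable def risk (M : Set (Measure (Euc d))) (v : Euc d → ℝ) (y : Euc d) : ℝ :=
  ⨆ ξ : M, ∫ z, v (y + z) ∂(ξ : Measure (Euc d))

lemma mfgCost_eq_quadCost (M : Set (Measure (Euc d))) (P : Euc d) (f : ℝ) (v : Euc d → ℝ)
    (x a : Euc d) : mfgCost M P f v x a = quadCost P f (risk M v) x a := rfl

lemma QuadBdd.continuous {c : ℝ} {v : Euc d → ℝ} (hv : QuadBdd c v) : Continuous v :=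
  hv.1.locallyLipschitz.continuous

lemma QuadBdd.mono {E : Type*} [NormedAddCommGroup E] [Module ℝ E] {c c' : ℝ} {v : E → ℝ}
    (hv : QuadBdd c v) (h : c ≤ c') : QuadBdd c' v :=
  ⟨hv.1, fun x => ⟨(neg_le_neg h).trans (hv.2 x).1,
    (hv.2 x).2.trans (mul_le_mul_of_nonneg_right h (by positivity))⟩⟩

lemma QuadBdd.integral_translate {c C : ℝ} {v : Euc d → ℝ} (hv : QuadBdd c v) (hc : 0 ≤ c)
    (hC : 0 ≤ C) {ξ : Measure (Euc d)} (hξ : SndMoment C ξ) (y : Euc d) :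
    Integrable (fun z => v (y + z)) ξ ∧ -c ≤ ∫ z, v (y + z) ∂ξ ∧
      ∫ z, v (y + z) ∂ξ ≤ c * (2 + 2 * C) * (1 + ‖y‖ ^ 2) := by
  have hvc := hv.continuous
  obtain ⟨h1, h2, h3⟩ := hξ.integral_le hC (f := fun z => v (y + z)) (k := c)
    (p := c * (1 + 2 * ‖y‖ ^ 2)) (q := c * 2) (by fun_prop) (fun z => (hv.2 _).1) (by positivity)
    fun z => by
      have h1 := (hv.2 (y + z)).2
      have h2 := mul_le_mul_of_nonneg_left (norm_add_sq_le_two y z) hc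
      linarith
  refine ⟨h1, h2, h3.trans ?_⟩
  have h4 : 0 ≤ c * C * ‖y‖ ^ 2 := by positivity
  nlinarith

lemma QuadBdd.bddAbove_risk {c C : ℝ} {v : Euc d → ℝ} (hv : QuadBdd c v) (hc : 0 ≤ c)
    (hC : 0 ≤ C) {M : Set (Measure (Euc d))} (hM : ∀ ξ ∈ M, SndMoment C ξ) (y : Euc d) :
    BddAbove (range fun ξ : M => ∫ z, v (y + z) ∂(ξ : Measure (Euc d))) :=
  ⟨_, by rintro _ ⟨ξ, rfl⟩; exact (hv.integral_translate hc hC (hM ξ ξ.2) y).2.2⟩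

lemma QuadBdd.worst_case {c C : ℝ} {v : Euc d → ℝ} (hv : QuadBdd c v) (hc : 0 ≤ c)
    (hC : 0 ≤ C) {M : Set (Measure (Euc d))} (hne : M.Nonempty) (hM : ∀ ξ ∈ M, SndMoment C ξ) :
    QuadBdd (c * (2 + 2 * C)) (risk M v) := by
  have : Nonempty M := hne.to_subtype
  refine ⟨⟨convex_univ, fun x _ y _ s t hs ht hst => ?_⟩, fun y => ⟨?_, ?_⟩⟩
  · refine ciSup_le fun ξ => ?_
    have hx := (hv.integral_translate hc hC (hM ξ ξ.2) x).1
    have hy := (hv.integral_translate hc hC (hM ξ ξ.2) y).1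
    calc ∫ z, v (s • x + t • y + z) ∂(ξ : Measure (Euc d))
        ≤ ∫ z, (s * v (x + z) + t * v (y + z)) ∂(ξ : Measure (Euc d)) := by
          refine integral_mono (hv.integral_translate hc hC (hM ξ ξ.2) _).1
            ((hx.const_mul s).add (hy.const_mul t)) fun z => ?_
          have h1 := hv.1.2 (mem_univ (x + z)) (mem_univ (y + z)) hs ht hst
          have h2 : s • x + t • y + z = s • (x + z) + t • (y + z) := by
            obtain rfl : t = 1 - s := by linarith
            module
          simpa only [h2, smul_eq_mul] using h1
      _ = s * (∫ z, v (x + z) ∂(ξ : Measure (Euc d))) +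
            t * ∫ z, v (y + z) ∂(ξ : Measure (Euc d)) := by
          rw [integral_add (hx.const_mul s) (hy.const_mul t), integral_const_mul,
            integral_const_mul]
      _ ≤ _ := add_le_add
          (mul_le_mul_of_nonneg_left (le_ciSup (hv.bddAbove_risk hc hC hM x) ξ) hs)
          (mul_le_mul_of_nonneg_left (le_ciSup (hv.bddAbove_risk hc hC hM y) ξ) ht)
  · obtain ⟨ξ⟩ := this
    have h1 := (hv.integral_translate hc hC (hM ξ ξ.2) y).2.1
    refine le_trans ?_ (h1.trans (le_ciSup (hv.bddAbove_risk hc hC hM y) ξ))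
    nlinarith [mul_nonneg hc hC]
  · exact ciSup_le fun ξ => (hv.integral_translate hc hC (hM ξ ξ.2) y).2.2

lemma risk_sub_le {c C ε : ℝ} {v v' : Euc d → ℝ} (hv : QuadBdd c v) (hv' : QuadBdd c v')
    (hc : 0 ≤ c) (hC : 0 ≤ C) (hε : 0 ≤ ε) {M : Set (Measure (Euc d))} (hne : M.Nonempty)
    (hM : ∀ ξ ∈ M, SndMoment C ξ) (h : ∀ x, v x - v' x ≤ ε * (1 + ‖x‖ ^ 2)) (y : Euc d) :
    risk M v y - risk M v' y ≤ ε * (2 + 2 * C) * (1 + ‖y‖ ^ 2) := by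
  have : Nonempty M := hne.to_subtype
  rw [sub_le_iff_le_add]
  refine ciSup_le fun ξ => ?_
  obtain ⟨i1, -, -⟩ := hv.integral_translate hc hC (hM ξ ξ.2) y
  obtain ⟨i2, -, -⟩ := hv'.integral_translate hc hC (hM ξ ξ.2) y
  have h1 : ∫ z, v' (y + z) ∂(ξ : Measure (Euc d)) ≤ risk M v' y :=
    le_ciSup (hv'.bddAbove_risk hc hC hM y) ξ
  have hp := (hM ξ ξ.2).1
  have j : Integrable (fun z => ε * (1 + 2 * ‖y‖ ^ 2) + ε * 2 * ‖z‖ ^ 2) (ξ : Measure (Euc d)) :=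
    (integrable_const _).add ((hM ξ ξ.2).integrable_norm_sq.const_mul _)
  have h2 : ∫ z, (v (y + z) - v' (y + z)) ∂(ξ : Measure (Euc d)) ≤
      ∫ z, (ε * (1 + 2 * ‖y‖ ^ 2) + ε * 2 * ‖z‖ ^ 2) ∂(ξ : Measure (Euc d)) :=
    integral_mono (i1.sub i2) j fun z => by
      have h2 := mul_le_mul_of_nonneg_left (norm_add_sq_le_two y z) hε
      have h3 := h (y + z)
      simp only
      linarith
  rw [integral_sub i1 i2, integral_add (integrable_const _)
    ((hM ξ ξ.2).integrable_norm_sq.const_mul _), integral_const_mul (ε * 2)] at h2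
  simp only [integral_const, probReal_univ, one_smul] at h2
  have h3 := mul_le_mul_of_nonneg_left ((hM ξ ξ.2).integral_norm_sq_le hC)
    (mul_nonneg hε zero_le_two)
  have h4 : 0 ≤ ε * C * ‖y‖ ^ 2 := by positivity
  linarith

lemma abs_risk_sub_le {c C ε : ℝ} {v v' : Euc d → ℝ} (hv : QuadBdd c v) (hv' : QuadBdd c v')
    (hc : 0 ≤ c) (hC : 0 ≤ C) (hε : 0 ≤ ε) {M : Set (Measure (Euc d))} (hne : M.Nonempty)
    (hM : ∀ ξ ∈ M, SndMoment C ξ) (h : ∀ x, |v x - v' x| ≤ ε * (1 + ‖x‖ ^ 2)) (y : Euc d) :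
    |risk M v y - risk M v' y| ≤ ε * (2 + 2 * C) * (1 + ‖y‖ ^ 2) :=
  abs_sub_le_iff.2 ⟨risk_sub_le hv hv' hc hC hε hne hM (fun x => (abs_sub_le_iff.1 (h x)).1) y,
    risk_sub_le hv' hv hc hC hε hne hM (fun x => (abs_sub_le_iff.1 (h x)).2) y⟩

end Risk

section Value

open Set Filter Topology

variable {d : ℕ}

/-- The value function of the risk-averse control problem, indexed by the time to go. -/
noncomputable def valueToGo (T : ℕ) (M : ℕ → Set (Measure (Euc d))) (P : ℕ → Euc d)
    (F : ℕ → Euc d → ℝ) : ℕ → Euc d → ℝ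
  | 0 => F T
  | k + 1 => fun x => ⨅ a, mfgCost (M (T - (k + 1))) (P (T - (k + 1))) (F (T - (k + 1)) x)
      (valueToGo T M P F k) x a

/-- The value function of the risk-averse control problem. -/
noncomputable def valueFn (T : ℕ) (M : ℕ → Set (Measure (Euc d))) (P : ℕ → Euc d)
    (F : ℕ → Euc d → ℝ) (t : ℕ) : Euc d → ℝ :=
  valueToGo T M P F (T - t)

lemma valueFn_terminal (T : ℕ) (M : ℕ → Set (Measure (Euc d))) (P : ℕ → Euc d)
    (F : ℕ → Euc d → ℝ) : valueFn T M P F T = F T := by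
  simp [valueFn, valueToGo]

lemma valueFn_of_lt {T t : ℕ} (ht : t < T) (M : ℕ → Set (Measure (Euc d))) (P : ℕ → Euc d)
    (F : ℕ → Euc d → ℝ) (x : Euc d) :
    valueFn T M P F t x =
      ⨅ a, mfgCost (M t) (P t) (F t x) (valueFn T M P F (t + 1)) x a := by
  have h1 : T - t = T - (t + 1) + 1 := by omega
  have h2 : T - (T - (t + 1) + 1) = t := by omega
  rw [valueFn, h1, valueToGo, h2]
  rfl

/-- The growth constant of the value function, in terms of the time to go. -/
noncomputable def valueConst (C : ℝ) : ℕ → ℝ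
  | 0 => C
  | k + 1 => C ^ 2 / 2 + C + valueConst C k * (2 + 2 * C)

/-- The Lipschitz constant of the value function in the data, in terms of the time to go. -/
noncomputable def valueStab (C : ℝ) : ℕ → ℝ
  | 0 => 1
  | k + 1 => (1 + valueStab C k * (2 + 2 * C)) * stabConst C (valueConst C k * (2 + 2 * C))

lemma valueConst_pos {C : ℝ} (hC : 0 < C) (k : ℕ) : 0 < valueConst C k := by
  induction k with
  | zero => exact hC
  | succ k ih => rw [valueConst]; positivity

lemma monotone_valueConst {C : ℝ} (hC : 0 < C) : Monotone (valueConst C) := by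
  refine monotone_nat_of_le_succ fun k => ?_
  rw [valueConst]
  have := valueConst_pos hC k
  nlinarith [mul_pos this hC, sq_nonneg C]

lemma valueStab_pos {C : ℝ} (hC : 0 < C) (k : ℕ) : 0 < valueStab C k := by
  induction k with
  | zero => exact one_pos
  | succ k ih =>
    rw [valueStab]
    have : 0 < stabConst C (valueConst C k * (2 + 2 * C)) := by unfold stabConst; positivity
    positivity

/-- The bounds on the data of the control problem. -/
structure CtrlBdd (C : ℝ) (T : ℕ) (P : ℕ → Euc d) (F : ℕ → Euc d → ℝ) : Prop where
  price : ∀ t < T, ‖P t‖ ≤ C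
  cost : ∀ t ≤ T, QuadBdd C (F t)

/-- The data of two control problems are at distance at most `ε`. -/
structure CtrlNear (ε : ℝ) (T : ℕ) (P P' : ℕ → Euc d) (F F' : ℕ → Euc d → ℝ) : Prop where
  price : ∀ t < T, ‖P t - P' t‖ ≤ ε
  cost : ∀ t ≤ T, ∀ x, |F t x - F' t x| ≤ ε * (1 + ‖x‖ ^ 2)

variable {T : ℕ} {M : ℕ → Set (Measure (Euc d))} {P P' : ℕ → Euc d} {F F' : ℕ → Euc d → ℝ}
  {C ε : ℝ}

lemma quadBdd_valueToGo (hC : 0 < C) (hne : ∀ t < T, (M t).Nonempty)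
    (hM : ∀ t < T, ∀ ξ ∈ M t, SndMoment C ξ) (h : CtrlBdd C T P F) (k : ℕ) (hk : k ≤ T) :
    QuadBdd (valueConst C k) (valueToGo T M P F k) := by
  induction k with
  | zero => exact h.cost T le_rfl
  | succ k ih =>
    have ht : T - (k + 1) < T := by omega
    rw [valueConst, valueToGo]
    simp only [mfgCost_eq_quadCost]
    exact quadBdd_iInf_quadCost
      ((ih (by omega)).worst_case (valueConst_pos hC k).le hC.le (hne _ ht) (hM _ ht))
      (h.cost _ ht.le) (h.price _ ht)

lemma quadBdd_valueFn (hC : 0 < C) (hne : ∀ t < T, (M t).Nonempty)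
    (hM : ∀ t < T, ∀ ξ ∈ M t, SndMoment C ξ) (h : CtrlBdd C T P F) (t : ℕ) :
    QuadBdd (valueConst C T) (valueFn T M P F t) :=
  (quadBdd_valueToGo hC hne hM h _ (Nat.sub_le _ _)).mono
    (monotone_valueConst hC (Nat.sub_le _ _))

lemma abs_valueToGo_sub_le (hC : 0 < C) (hne : ∀ t < T, (M t).Nonempty)
    (hM : ∀ t < T, ∀ ξ ∈ M t, SndMoment C ξ) (h : CtrlBdd C T P F) (h' : CtrlBdd C T P' F')
    (hε : 0 ≤ ε) (hn : CtrlNear ε T P P' F F') (k : ℕ) (hk : k ≤ T) (x : Euc d) :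
    |valueToGo T M P F k x - valueToGo T M P' F' k x| ≤
      ε * valueStab C k * (1 + ‖x‖ ^ 2) := by
  induction k generalizing x with
  | zero => simpa [valueStab, valueToGo] using hn.cost T le_rfl x
  | succ k ih =>
    have ht : T - (k + 1) < T := by omega
    have hv := valueConst_pos hC k
    have hs := valueStab_pos hC k
    have hq := quadBdd_valueToGo hC hne hM h k (by omega)
    have hq' := quadBdd_valueToGo hC hne hM h' k (by omega)
    have hle : ε ≤ ε * (1 + valueStab C k * (2 + 2 * C)) :=
      le_mul_of_one_le_right hε (le_add_of_nonneg_right (by positivity))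
    have key := abs_iInf_quadCost_sub_le (ε := ε * (1 + valueStab C k * (2 + 2 * C))) (x := x)
      (f := F (T - (k + 1)) x) (f' := F' (T - (k + 1)) x)
      (by positivity) (hq.worst_case hv.le hC.le (hne _ ht) (hM _ ht))
      (hq'.worst_case hv.le hC.le (hne _ ht) (hM _ ht)) (h.price _ ht) (h'.price _ ht)
      (by positivity) ((hn.price _ ht).trans hle)
      ((hn.cost _ ht.le x).trans (mul_le_mul_of_nonneg_right hle (by positivity)))
      fun y => (abs_risk_sub_le hq hq' hv.le hC.le (by positivity) (hne _ ht) (hM _ ht)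
        (ih (by omega)) y).trans (mul_le_mul_of_nonneg_right (by nlinarith) (by positivity))
    rw [valueStab, ← mul_assoc]
    exact key

/-- An optimal feedback control. -/
noncomputable def policy (T : ℕ) (M : ℕ → Set (Measure (Euc d))) (P : ℕ → Euc d)
    (F : ℕ → Euc d → ℝ) (t : ℕ) (x : Euc d) : Euc d :=
  if t < T then Classical.epsilon fun a => ∀ a',
    mfgCost (M t) (P t) (F t x) (valueFn T M P F (t + 1)) x a ≤
      mfgCost (M t) (P t) (F t x) (valueFn T M P F (t + 1)) x a'
  else 0

/-- The linear growth constant of optimal feedback controls. -/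
noncomputable def policyConst (C : ℝ) (T : ℕ) : ℝ :=
  ctrlConst C (valueConst C T * (2 + 2 * C))

lemma policyConst_pos (hC : 0 < C) (T : ℕ) : 0 < policyConst C T := by
  have := valueConst_pos hC T
  unfold policyConst ctrlConst
  positivity

lemma quadBdd_risk_valueFn (hC : 0 < C) (hne : ∀ t < T, (M t).Nonempty)
    (hM : ∀ t < T, ∀ ξ ∈ M t, SndMoment C ξ) (h : CtrlBdd C T P F) {t : ℕ} (ht : t < T) :
    QuadBdd (valueConst C T * (2 + 2 * C)) (risk (M t) (valueFn T M P F (t + 1))) :=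
  (quadBdd_valueFn hC hne hM h (t + 1)).worst_case (valueConst_pos hC T).le hC.le (hne t ht)
    (hM t ht)

lemma policy_isMin (hC : 0 < C) (hne : ∀ t < T, (M t).Nonempty)
    (hM : ∀ t < T, ∀ ξ ∈ M t, SndMoment C ξ) (h : CtrlBdd C T P F) {t : ℕ} (ht : t < T)
    (x a : Euc d) :
    mfgCost (M t) (P t) (F t x) (valueFn T M P F (t + 1)) x (policy T M P F t x) ≤
      mfgCost (M t) (P t) (F t x) (valueFn T M P F (t + 1)) x a := by
  rw [policy, if_pos ht]
  exact Classical.epsilon_spec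
    (exists_isMin_quadCost (P := P t) (f := F t x) (quadBdd_risk_valueFn hC hne hM h ht) x) a

lemma lipschitzWith_policy (hC : 0 < C) (hne : ∀ t < T, (M t).Nonempty)
    (hM : ∀ t < T, ∀ ξ ∈ M t, SndMoment C ξ) (h : CtrlBdd C T P F) (t : ℕ) :
    LipschitzWith 1 (policy T M P F t) := by
  refine LipschitzWith.of_dist_le_mul fun x y => ?_
  rw [NNReal.coe_one, one_mul, dist_eq_norm, dist_eq_norm]
  by_cases ht : t < T
  · exact norm_argmin_sub_le (quadBdd_risk_valueFn hC hne hM h ht).1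
      (policy_isMin hC hne hM h ht x) (policy_isMin hC hne hM h ht y)
  · simp [policy, ht]

lemma norm_policy_le (hC : 0 < C) (hne : ∀ t < T, (M t).Nonempty)
    (hM : ∀ t < T, ∀ ξ ∈ M t, SndMoment C ξ) (h : CtrlBdd C T P F) (t : ℕ) (x : Euc d) :
    ‖policy T M P F t x‖ ≤ policyConst C T * (1 + ‖x‖) := by
  by_cases ht : t < T
  · have := valueConst_pos hC T
    exact norm_argmin_le (by positivity) (quadBdd_risk_valueFn hC hne hM h ht) (h.price t ht)
      (policy_isMin hC hne hM h ht x)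
  · have := policyConst_pos hC T
    simp only [policy, ht, if_false, norm_zero]
    positivity

/-- The Hölder constant of optimal feedback controls in the data. -/
noncomputable def policyStab (C : ℝ) (T t : ℕ) : ℝ :=
  4 * ((1 + valueStab C (T - (t + 1)) * (2 + 2 * C)) *
    stabConst C (valueConst C T * (2 + 2 * C)))

lemma norm_policy_sub_sq_le (hC : 0 < C) (hne : ∀ t < T, (M t).Nonempty)
    (hM : ∀ t < T, ∀ ξ ∈ M t, SndMoment C ξ) (h : CtrlBdd C T P F) (h' : CtrlBdd C T P' F')
    (hε : 0 ≤ ε) (hn : CtrlNear ε T P P' F F') {t : ℕ} (ht : t < T) (x : Euc d) :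
    ‖policy T M P' F' t x - policy T M P F t x‖ ^ 2 ≤
      ε * policyStab C T t * (1 + ‖x‖ ^ 2) := by
  have hv := valueConst_pos hC T
  have hs := valueStab_pos hC (T - (t + 1))
  have hle : ε ≤ ε * (1 + valueStab C (T - (t + 1)) * (2 + 2 * C)) :=
    le_mul_of_one_le_right hε (le_add_of_nonneg_right (by positivity))
  have key := norm_argmin_sub_sq_le
    (ε := ε * (1 + valueStab C (T - (t + 1)) * (2 + 2 * C))) (x := x) (by positivity)
    (quadBdd_risk_valueFn hC hne hM h ht) (quadBdd_risk_valueFn hC hne hM h' ht)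
    (h.price t ht) (h'.price t ht) (by positivity) ((hn.price t ht).trans hle)
    ((hn.cost t ht.le x).trans (mul_le_mul_of_nonneg_right hle (by positivity)))
    (fun y => (abs_risk_sub_le (quadBdd_valueFn hC hne hM h (t + 1))
      (quadBdd_valueFn hC hne hM h' (t + 1)) hv.le hC.le (by positivity) (hne t ht) (hM t ht)
      (abs_valueToGo_sub_le hC hne hM h h' hε hn _ (Nat.sub_le _ _)) y).trans
        (mul_le_mul_of_nonneg_right (by nlinarith) (by positivity)))
    (policy_isMin hC hne hM h ht x) (policy_isMin hC hne hM h' ht x)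
  refine key.trans (le_of_eq ?_)
  rw [policyStab]
  ring

end Value

section Flow

open Set Filter Topology

/-- The Kantorovich–Rubinstein distance of `μ` and `ν` is at most `e`. -/
def KRLe {X : Type*} [MeasurableSpace X] [NormedAddCommGroup X] (e : ℝ) (μ ν : Measure X) :
    Prop :=
  ∀ φ : X → ℝ, LipschitzWith 1 φ → ∫ x, φ x ∂μ - ∫ x, φ x ∂ν ≤ e

lemma KRLe.d1_le {X : Type*} [MeasurableSpace X] [NormedAddCommGroup X] {e : ℝ}
    {μ ν : Measure X} (h : KRLe e μ ν) (he : 0 ≤ e) : d1 μ ν ≤ e :=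
  Real.sSup_le (by rintro _ ⟨φ, hφ, rfl⟩; exact h φ hφ) he

section Transport

variable {X Y : Type*} [MeasurableSpace X] [NormedAddCommGroup X] [BorelSpace X]
  [MeasurableSpace Y] [NormedAddCommGroup Y] [BorelSpace Y]

lemma SndMoment.map {c p q : ℝ} {ξ : Measure X} (h : SndMoment c ξ) (hc : 0 ≤ c) {g : X → Y}
    (hg : Measurable g) (hq : 0 ≤ q) (hle : ∀ x, ‖g x‖ ^ 2 ≤ p + q * ‖x‖ ^ 2) :
    SndMoment (p + q * c) (ξ.map g) := by
  have := h.1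
  have := Measure.isProbabilityMeasure_map hg.aemeasurable (μ := ξ)
  have hm : Measurable fun y : Y => ‖y‖ ^ 2 := by fun_prop
  obtain ⟨h1, -, h3⟩ := h.integral_le hc (f := fun x => ‖g x‖ ^ 2) (k := 0)
    (hm.comp hg).aestronglyMeasurable (fun x => by simp) hq hle
  refine SndMoment.of_integral ?_ ?_
  · exact (integrable_map_measure hm.aestronglyMeasurable hg.aemeasurable).2 h1
  · rwa [integral_map hg.aemeasurable hm.aestronglyMeasurable]

lemma KRLe.map {e δ c : ℝ} {μ ν : Measure X} (h : KRLe e μ ν) (hν : SndMoment c ν)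
    {g g' : X → Y} (hg : LipschitzWith 2 g) (hg' : LipschitzWith 2 g')
    (hδ : ∫ x, ‖g' x - g x‖ ∂ν ≤ δ) (hi : Integrable (fun x => ‖g' x - g x‖) ν) :
    KRLe (2 * e + δ) (μ.map g') (ν.map g) := by
  intro φ hφ
  rw [integral_map hg'.continuous.measurable.aemeasurable hφ.continuous.aestronglyMeasurable,
    integral_map hg.continuous.measurable.aemeasurable hφ.continuous.aestronglyMeasurable]
  have l1 : LipschitzWith 2 (fun x => φ (g x)) := by simpa [Function.comp_def] using hφ.comp hg
  have l2 : LipschitzWith 2 (fun x => φ (g' x)) := by simpa [Function.comp_def] using hφ.comp hg'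
  have l3 : LipschitzWith 1 (fun x => (1 / 2 : ℝ) * φ (g' x)) := by
    refine LipschitzWith.of_dist_le_mul fun x y => ?_
    have := l2.dist_le_mul x y
    rw [Real.dist_eq] at *
    rw [← mul_sub, abs_mul, abs_of_pos (by norm_num : (0 : ℝ) < 1 / 2)]
    simp only [NNReal.coe_one, NNReal.coe_ofNat] at *
    linarith
  have h1 := h _ l3
  rw [integral_const_mul, integral_const_mul] at h1
  have h2 : ∫ x, (φ (g' x) - φ (g x)) ∂ν ≤ ∫ x, ‖g' x - g x‖ ∂ν := by
    refine integral_mono ((hν.integrable_of_lipschitz l2).sub (hν.integrable_of_lipschitz l1)) hi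
      fun x => ?_
    have := hφ.dist_le_mul (g' x) (g x)
    rw [Real.dist_eq, dist_eq_norm] at this
    simpa using (le_abs_self _).trans this
  rw [integral_sub (hν.integrable_of_lipschitz l2) (hν.integrable_of_lipschitz l1)] at h2
  linarith

end Transport

variable {d : ℕ}

lemma SndMoment.mconv {a b : ℝ} {μ ν : Measure (Euc d)} (hμ : SndMoment a μ)
    (hν : SndMoment b ν) (ha : 0 ≤ a) (hb : 0 ≤ b) : SndMoment (2 * a + 2 * b) (mconv μ ν) := by
  have := hμ.1
  have := hν.1
  have hadd : Measurable fun q : Euc d × Euc d => q.1 + q.2 := by fun_prop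
  have : IsProbabilityMeasure (_root_.mconv μ ν) :=
    Measure.isProbabilityMeasure_map hadd.aemeasurable
  have i1 : Integrable (fun q : Euc d × Euc d => 2 * ‖q.1‖ ^ 2) (μ.prod ν) :=
    (hμ.integrable_norm_sq.const_mul 2).comp_fst ν
  have i2 : Integrable (fun q : Euc d × Euc d => 2 * ‖q.2‖ ^ 2) (μ.prod ν) :=
    (hν.integrable_norm_sq.const_mul 2).comp_snd μ
  have hm : Measurable fun y : Euc d => ‖y‖ ^ 2 := by fun_prop
  have i3 : Integrable (fun q : Euc d × Euc d => ‖q.1 + q.2‖ ^ 2) (μ.prod ν) :=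
    (i1.add i2).mono' (hm.comp hadd).aestronglyMeasurable (Eventually.of_forall fun q => by
      simpa using norm_add_sq_le_two q.1 q.2)
  refine SndMoment.of_integral ?_ ?_
  · exact (integrable_map_measure hm.aestronglyMeasurable hadd.aemeasurable).2 i3
  · rw [_root_.mconv, integral_map hadd.aemeasurable hm.aestronglyMeasurable]
    refine (integral_mono i3 (i1.add i2) fun q => norm_add_sq_le_two q.1 q.2).trans ?_
    rw [integral_add' i1 i2, integral_fun_fst (fun x : Euc d => 2 * ‖x‖ ^ 2),
      integral_fun_snd (fun x : Euc d => 2 * ‖x‖ ^ 2), integral_const_mul, integral_const_mul]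
    simp only [probReal_univ, one_smul]
    linarith [hμ.integral_norm_sq_le ha, hν.integral_norm_sq_le hb]

lemma integral_mconv {a b : ℝ} {μ ν : Measure (Euc d)} (hμ : SndMoment a μ)
    (hν : SndMoment b ν) (ha : 0 ≤ a) (hb : 0 ≤ b) {φ : Euc d → ℝ} (hφ : LipschitzWith 1 φ) :
    ∫ x, φ x ∂(mconv μ ν) = ∫ y, ∫ z, φ (z + y) ∂μ ∂ν := by
  have := hμ.1
  have := hν.1
  have hadd : Measurable fun q : Euc d × Euc d => q.1 + q.2 := by fun_prop
  have i1 := (hμ.mconv hν ha hb).integrable_of_lipschitz hφ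
  rw [mconv, integrable_map_measure hφ.continuous.aestronglyMeasurable hadd.aemeasurable] at i1
  rw [mconv, integral_map hadd.aemeasurable hφ.continuous.aestronglyMeasurable]
  exact integral_prod_symm _ i1

lemma KRLe.mconv {e a b : ℝ} {μ ν ν' : Measure (Euc d)} (h : KRLe e ν' ν) (hμ : SndMoment a μ)
    (hν : SndMoment b ν) (hν' : SndMoment b ν') (ha : 0 ≤ a) (hb : 0 ≤ b) :
    KRLe e (mconv μ ν') (mconv μ ν) := by
  intro φ hφ
  rw [integral_mconv hμ hν ha hb hφ, integral_mconv hμ hν' ha hb hφ]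
  refine h _ (LipschitzWith.of_dist_le_mul fun x y => ?_)
  have := hμ.1
  have hi : ∀ x, Integrable (fun z => φ (z + x)) μ := fun x =>
    hμ.integrable_of_lipschitz (K := 1) (LipschitzWith.of_dist_le_mul fun z z' => by
      simpa using hφ.dist_le_mul (z + x) (z' + x))
  rw [Real.dist_eq, ← integral_sub (hi x) (hi y)]
  have := norm_integral_le_of_norm_le_const (μ := μ) (f := fun z => φ (z + x) - φ (z + y))
    (C := dist x y) (Eventually.of_forall fun z => by
      simpa [Real.dist_eq] using hφ.dist_le_mul (z + x) (z + y))
  simpa using this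

/-- Nonexpansive feedback controls of linear growth. -/
def ctrlSet (d : ℕ) (A : ℝ) : Set (ℕ → Euc d → Euc d) :=
  {α | ∀ t, LipschitzWith 1 (α t) ∧ ∀ x, ‖α t x‖ ≤ A * (1 + ‖x‖)}

lemma zero_mem_ctrlSet {A : ℝ} (hA : 0 ≤ A) : (0 : ℕ → Euc d → Euc d) ∈ ctrlSet d A :=
  fun _ => ⟨(LipschitzWith.const 0).weaken zero_le_one, fun x => by
    simp only [Pi.zero_apply, norm_zero]; positivity⟩

lemma convex_ctrlSet (A : ℝ) : Convex ℝ (ctrlSet d A) := by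
  intro α hα β hβ s r hs hr hsr t
  refine ⟨LipschitzWith.of_dist_le_mul fun x y => ?_, fun x => ?_⟩
  · have h1 := (hα t).1.dist_le_mul x y
    have h2 := (hβ t).1.dist_le_mul x y
    simp only [NNReal.coe_one, one_mul, dist_eq_norm, Pi.add_apply, Pi.smul_apply] at *
    have e : s • α t x + r • β t x - (s • α t y + r • β t y) =
      s • (α t x - α t y) + r • (β t x - β t y) := by module
    rw [e]
    refine (norm_add_le _ _).trans ?_
    rw [norm_smul, norm_smul, Real.norm_of_nonneg hs, Real.norm_of_nonneg hr]
    calc _ ≤ s * ‖x - y‖ + r * ‖x - y‖ := by gcongr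
      _ = ‖x - y‖ := by rw [← add_mul, hsr, one_mul]
  · simp only [Pi.add_apply, Pi.smul_apply]
    refine (norm_add_le _ _).trans ?_
    rw [norm_smul, norm_smul, Real.norm_of_nonneg hs, Real.norm_of_nonneg hr]
    calc _ ≤ s * (A * (1 + ‖x‖)) + r * (A * (1 + ‖x‖)) := by
          gcongr
          exacts [(hα t).2 x, (hβ t).2 x]
      _ = A * (1 + ‖x‖) := by rw [← add_mul, hsr, one_mul]

lemma isCompact_ctrlSet (A : ℝ) : IsCompact (ctrlSet d A) := by
  have hK : IsCompact (univ.pi fun _ : ℕ => univ.pi fun x : Euc d =>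
      Metric.closedBall (0 : Euc d) (A * (1 + ‖x‖))) :=
    isCompact_univ_pi fun _ => isCompact_univ_pi fun _ => isCompact_closedBall _ _
  refine hK.of_isClosed_subset ?_ fun α hα => ?_
  · have : ctrlSet d A = ⋂ t, ⋂ x, ⋂ y, {α : ℕ → Euc d → Euc d |
        dist (α t x) (α t y) ≤ dist x y ∧ ‖α t x‖ ≤ A * (1 + ‖x‖)} := by
      ext α
      simp only [ctrlSet, lipschitzWith_iff_dist_le_mul, NNReal.coe_one, one_mul, mem_ofPred_eq,
        mem_iInter]
      exact ⟨fun h t x y => ⟨(h t).1 x y, (h t).2 x⟩,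
        fun h t => ⟨fun x y => (h t x y).1, fun x => (h t x x).2⟩⟩
    rw [this]
    refine isClosed_iInter fun t => isClosed_iInter fun x => isClosed_iInter fun y => ?_
    have hev : ∀ z, Continuous fun α : ℕ → Euc d → Euc d => α t z := fun z => by fun_prop
    exact (isClosed_le ((hev x).dist (hev y)) continuous_const).inter
      (isClosed_le (hev x).norm continuous_const)
  · simp only [mem_univ_pi, mem_closedBall_zero_iff]
    exact fun t x => (hα t).2 x

lemma norm_sub_le_of_mem_ctrlSet {A : ℝ} {α α' : ℕ → Euc d → Euc d} (hα : α ∈ ctrlSet d A)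
    (hα' : α' ∈ ctrlSet d A) (t : ℕ) (x : Euc d) :
    ‖α' t x - α t x‖ ≤ 2 * A * (1 + ‖x‖) :=
  (norm_sub_le _ _).trans (by linarith [(hα t).2 x, (hα' t).2 x])

lemma integrable_norm_sub_ctrl {A c : ℝ} {α α' : ℕ → Euc d → Euc d} (hα : α ∈ ctrlSet d A)
    (hα' : α' ∈ ctrlSet d A) (t : ℕ) {m : Measure (Euc d)} (hm : SndMoment c m) :
    Integrable (fun x => ‖α' t x - α t x‖) m :=
  hm.integrable_of_lipschitz (lipschitzWith_one_norm.comp ((hα' t).1.sub (hα t).1))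

/-- In the pointwise topology on nonexpansive controls, controls close to `α` are close to it in
mean. -/
lemma eventually_integral_norm_sub_le {A c : ℝ} (hA : 0 ≤ A) (hc : 0 ≤ c)
    {α : ℕ → Euc d → Euc d} (hα : α ∈ ctrlSet d A) (t : ℕ) {m : Measure (Euc d)}
    (hm : SndMoment c m) {δ : ℝ} (hδ : 0 < δ) :
    ∀ᶠ α' in 𝓝[ctrlSet d A] α, ∫ x, ‖α' t x - α t x‖ ∂m ≤ δ := by
  set R : ℝ := 8 * A * (1 + c) / δ with hR
  have hR0 : 0 ≤ R := by positivity
  obtain ⟨s, -, hsf, hs⟩ := (isCompact_closedBall (0 : Euc d) R).finite_cover_balls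
    (e := δ / 8) (by positivity)
  have hev : ∀ᶠ α' in 𝓝[ctrlSet d A] α, ∀ y ∈ s, ‖α' t y - α t y‖ < δ / 4 := by
    refine (eventually_all_finite hsf).2 fun y _ => ?_
    have hcont : Continuous fun α' : ℕ → Euc d → Euc d => ‖α' t y - α t y‖ := by fun_prop
    have := hcont.continuousAt (x := α)
    refine eventually_nhdsWithin_of_eventually_nhds ?_
    exact this.eventually (gt_mem_nhds (by simpa using by positivity))
  filter_upwards [hev, self_mem_nhdsWithin] with α' h1 hα'
  have hpt : ∀ x, ‖α' t x - α t x‖ ≤ (δ / 2 + 4 * A / (1 + R)) + 4 * A / (1 + R) * ‖x‖ ^ 2 := by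
    intro x
    have hq : 0 ≤ 4 * A / (1 + R) := by positivity
    rcases le_or_gt ‖x‖ R with hx | hx
    · obtain ⟨y, hy, hxy⟩ := mem_iUnion₂.1 (hs (mem_closedBall_zero_iff.2 hx))
      have h2 := (hα' t).1.dist_le_mul x y
      have h3 := (hα t).1.dist_le_mul y x
      have h4 := h1 y hy
      rw [← dist_eq_norm] at h4 ⊢
      rw [dist_comm y x] at h3
      rw [Metric.mem_ball] at hxy
      simp only [NNReal.coe_one, one_mul] at h2 h3
      have h5 := dist_triangle4 (α' t x) (α' t y) (α t y) (α t x)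
      have h6 : 0 ≤ 4 * A / (1 + R) * ‖x‖ ^ 2 := by positivity
      linarith
    · have h2 := norm_sub_le_of_mem_ctrlSet hα hα' t x
      have h3 : 2 * A * (1 + ‖x‖) ≤ 4 * A / (1 + R) * (1 + ‖x‖ ^ 2) := by
        rw [div_mul_eq_mul_div, le_div_iff₀ (by positivity)]
        have h4 : (1 + ‖x‖) * (1 + R) ≤ 2 * (1 + ‖x‖ ^ 2) := by
          nlinarith [sq_nonneg (1 - ‖x‖), norm_nonneg x]
        nlinarith
      linarith
  obtain ⟨-, -, h⟩ := hm.integral_le hc (integrable_norm_sub_ctrl hα hα' t hm).1 (k := 0)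
    (fun x => by simp) (by positivity) hpt
  refine h.trans ?_
  have h3 : 4 * A / (1 + R) * (1 + c) ≤ δ / 2 := by
    rw [div_mul_eq_mul_div, div_le_iff₀ (by positivity)]
    have : δ * R = 8 * A * (1 + c) := by rw [hR]; field_simp
    nlinarith
  linarith

/-- The flow of state distributions under the feedback control `α`. -/
noncomputable def flow (mbar : Measure (Euc d)) (ν : ℕ → Measure (Euc d))
    (α : ℕ → Euc d → Euc d) : ℕ → Measure (Euc d)
  | 0 => mbar
  | t + 1 => mconv (ν t) ((flow mbar ν α t).map fun x => x + α t x)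

/-- The belief induced by the feedback control `α`. -/
noncomputable def belief (T : ℕ) (mbar : Measure (Euc d)) (ν : ℕ → Measure (Euc d))
    (α : ℕ → Euc d → Euc d) : B2 T d :=
  (fun t : Fin T => (flow mbar ν α t).map (pairMap (α t)), flow mbar ν α T)

/-- Bound on the second moments of the flow. -/
noncomputable def flowConst (C A : ℝ) : ℕ → ℝ
  | 0 => C
  | t + 1 => 2 * C + 2 * (4 * A ^ 2 + (2 + 4 * A ^ 2) * flowConst C A t)

lemma flowConst_pos {C A : ℝ} (hC : 0 < C) (t : ℕ) : 0 < flowConst C A t := by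
  induction t with
  | zero => exact hC
  | succ t ih => rw [flowConst]; positivity

lemma monotone_flowConst {C A : ℝ} (hC : 0 < C) : Monotone (flowConst C A) := by
  refine monotone_nat_of_le_succ fun t => ?_
  rw [flowConst]
  have := flowConst_pos (A := A) hC t
  nlinarith [mul_nonneg this.le (sq_nonneg A), sq_nonneg A]

/-- Bound on the second moments of the joint distributions of states and controls. -/
noncomputable def jointConst (C A : ℝ) (T : ℕ) : ℝ :=
  2 * A ^ 2 + (1 + 2 * A ^ 2) * flowConst C A T

lemma norm_sq_le_of_mem_ctrlSet {A : ℝ} {α : ℕ → Euc d → Euc d} (hα : α ∈ ctrlSet d A) (t : ℕ)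
    (x : Euc d) : ‖α t x‖ ^ 2 ≤ 2 * A ^ 2 + 2 * A ^ 2 * ‖x‖ ^ 2 := by
  have := pow_le_pow_left₀ (norm_nonneg _) ((hα t).2 x) 2
  nlinarith [mul_nonneg (sq_nonneg A) (sq_nonneg (1 - ‖x‖))]

lemma norm_pairMap_sq (a : Euc d → Euc d) (x : Euc d) :
    ‖pairMap a x‖ ^ 2 = ‖x‖ ^ 2 + ‖a x‖ ^ 2 := by
  rw [WithLp.prod_norm_sq_eq_of_L2]
  rfl

lemma norm_pairMap_sub_sq (a b : Euc d → Euc d) (x y : Euc d) :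
    ‖pairMap a x - pairMap b y‖ ^ 2 = ‖x - y‖ ^ 2 + ‖a x - b y‖ ^ 2 := by
  rw [WithLp.prod_norm_sq_eq_of_L2]
  rfl

lemma lipschitzWith_pairMap {a : Euc d → Euc d} (ha : LipschitzWith 1 a) :
    LipschitzWith 2 (pairMap a) := by
  refine LipschitzWith.of_dist_le_mul fun x y => ?_
  have h1 := ha.dist_le_mul x y
  rw [dist_eq_norm, dist_eq_norm] at *
  have h2 := norm_pairMap_sub_sq a a x y
  simp only [NNReal.coe_one, one_mul, NNReal.coe_ofNat] at *
  refine le_of_sq_le_sq ?_ (by positivity)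
  nlinarith [norm_nonneg (a x - a y), norm_nonneg (x - y)]

lemma norm_pairMap_sub (a b : Euc d → Euc d) (x : Euc d) :
    ‖pairMap a x - pairMap b x‖ = ‖a x - b x‖ := by
  have h2 := norm_pairMap_sub_sq a b x x
  rw [sub_self, norm_zero] at h2
  exact (sq_eq_sq₀ (norm_nonneg _) (norm_nonneg _)).1 (by linarith)

lemma lipschitzWith_id_add {a : Euc d → Euc d} (ha : LipschitzWith 1 a) :
    LipschitzWith 2 fun x => x + a x := by
  simpa [one_add_one_eq_two] using LipschitzWith.id.add ha

variable {T : ℕ} {mbar : Measure (Euc d)} {ν : ℕ → Measure (Euc d)} {C A : ℝ}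
  {α : ℕ → Euc d → Euc d}

lemma sndMoment_step {c : ℝ} (hc : 0 ≤ c) (hα : α ∈ ctrlSet d A) {m : Measure (Euc d)}
    (hm : SndMoment c m) (t : ℕ) :
    SndMoment (4 * A ^ 2 + (2 + 4 * A ^ 2) * c) (m.map fun x => x + α t x) :=
  hm.map hc (lipschitzWith_id_add (hα t).1).continuous.measurable (by positivity) fun x => by
    have h1 := norm_add_sq_le_two x (α t x)
    have h2 := norm_sq_le_of_mem_ctrlSet hα t x
    linarith

lemma sndMoment_flow (hC : 0 < C) (hm : SndMoment C mbar) (hν : ∀ t < T, SndMoment C (ν t))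
    (hα : α ∈ ctrlSet d A) (t : ℕ) (ht : t ≤ T) :
    SndMoment (flowConst C A t) (flow mbar ν α t) := by
  induction t with
  | zero => exact hm
  | succ t ih =>
    have := flowConst_pos (A := A) hC t
    rw [flow, flowConst]
    exact (hν t ht).mconv (sndMoment_step this.le hα (ih (by omega)) t) hC.le (by positivity)

lemma sndMoment_joint (hC : 0 < C) (hm : SndMoment C mbar) (hν : ∀ t < T, SndMoment C (ν t))
    (hα : α ∈ ctrlSet d A) (t : ℕ) (ht : t ≤ T) :
    SndMoment (jointConst C A T) ((flow mbar ν α t).map (pairMap (α t))) := by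
  have h := (sndMoment_flow hC hm hν hα t ht).mono (monotone_flowConst hC ht)
  refine h.map (flowConst_pos hC T).le (lipschitzWith_pairMap (hα t).1).continuous.measurable
    (by positivity) fun x => ?_
  rw [norm_pairMap_sq]
  linarith [norm_sq_le_of_mem_ctrlSet hα t x]

lemma memB2_belief (hC : 0 < C) (hm : SndMoment C mbar) (hν : ∀ t < T, SndMoment C (ν t))
    (hα : α ∈ ctrlSet d A) : MemB2 (belief T mbar ν α) := by
  refine ⟨fun t => ?_, ?_⟩
  · have := sndMoment_joint hC hm hν hα t t.2.le
    exact ⟨this.1, this.2.trans_lt ENNReal.ofReal_lt_top⟩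
  · have := sndMoment_flow hC hm hν hα T le_rfl
    exact ⟨this.1, this.2.trans_lt ENNReal.ofReal_lt_top⟩

lemma eventually_krLe_flow (hC : 0 < C) (hA : 0 ≤ A) (hm : SndMoment C mbar)
    (hν : ∀ t < T, SndMoment C (ν t)) (hα : α ∈ ctrlSet d A) (t : ℕ) (ht : t ≤ T) {e : ℝ}
    (he : 0 < e) :
    ∀ᶠ α' in 𝓝[ctrlSet d A] α, KRLe e (flow mbar ν α' t) (flow mbar ν α t) := by
  induction t generalizing e with
  | zero => exact Eventually.of_forall fun α' φ _ => by simpa [flow] using he.le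
  | succ t ih =>
    have hc := flowConst_pos (A := A) hC t
    have hft := sndMoment_flow hC hm hν hα t (by omega)
    filter_upwards [ih (by omega) (e := e / 4) (by positivity), self_mem_nhdsWithin,
      eventually_integral_norm_sub_le hA hc.le hα t hft (δ := e / 2) (by positivity)]
      with α' h1 hα' h2
    have hft' := sndMoment_flow hC hm hν hα' t (by omega)
    have h3 := h1.map (δ := e / 2) hft (lipschitzWith_id_add (hα t).1)
      (lipschitzWith_id_add (hα' t).1) (by simpa using h2)
      (by simpa using integrable_norm_sub_ctrl hα hα' t hft)
    have h4 : 2 * (e / 4) + e / 2 = e := by ring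
    rw [h4] at h3
    exact h3.mconv (hν t ht) (sndMoment_step hc.le hα hft t) (sndMoment_step hc.le hα' hft' t)
      hC.le (by positivity)

lemma eventually_d1B_belief_le (hC : 0 < C) (hA : 0 ≤ A) (hm : SndMoment C mbar)
    (hν : ∀ t < T, SndMoment C (ν t)) (hα : α ∈ ctrlSet d A) {e : ℝ} (he : 0 < e) :
    ∀ᶠ α' in 𝓝[ctrlSet d A] α, d1B (belief T mbar ν α') (belief T mbar ν α) ≤ e := by
  set δ : ℝ := e / (T + 1) with hδ
  have hδ0 : 0 < δ := by positivity
  have hjoint : ∀ᶠ α' in 𝓝[ctrlSet d A] α, ∀ t : Fin T,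
      d1 ((belief T mbar ν α').1 t) ((belief T mbar ν α).1 t) ≤ δ := by
    refine eventually_all.2 fun t => ?_
    have hft := sndMoment_flow hC hm hν hα t t.2.le
    filter_upwards [eventually_krLe_flow hC hA hm hν hα t t.2.le (e := δ / 4) (by positivity),
      self_mem_nhdsWithin, eventually_integral_norm_sub_le hA (flowConst_pos hC _).le hα t hft
        (δ := δ / 2) (by positivity)] with α' h1 hα' h2
    have h3 := h1.map (δ := δ / 2) hft
      (lipschitzWith_pairMap (hα t).1) (lipschitzWith_pairMap (hα' t).1)
      (by simpa only [norm_pairMap_sub] using h2)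
      (by simpa only [norm_pairMap_sub] using integrable_norm_sub_ctrl hα hα' t hft)
    have h4 : 2 * (δ / 4) + δ / 2 = δ := by ring
    rw [h4] at h3
    exact h3.d1_le hδ0.le
  filter_upwards [hjoint, eventually_krLe_flow hC hA hm hν hα T le_rfl hδ0] with α' h1 h2
  have h3 := Finset.sum_le_sum fun t (_ : t ∈ Finset.univ) => h1 t
  have h4 : d1 (belief T mbar ν α').2 (belief T mbar ν α).2 ≤ δ := h2.d1_le hδ0.le
  have h5 : (T : ℝ) * δ + δ = e := by rw [hδ]; field_simp
  simp only [Finset.sum_const, Finset.card_univ, Fintype.card_fin, nsmul_eq_mul] at h3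
  rw [d1B]
  linarith

end Flow

section Equilibrium

open Set Filter Topology

variable {d T : ℕ} {mbar : Measure (Euc d)} {ν : ℕ → Measure (Euc d)}
  {M : ℕ → Set (Measure (Euc d))} {P : ℕ → B2 T d → Euc d} {F : ℕ → Euc d → B2 T d → ℝ}
  {C A : ℝ}

/-- The best response to the belief induced by the feedback control `α`. -/
noncomputable def bestResponse (T : ℕ) (mbar : Measure (Euc d)) (ν : ℕ → Measure (Euc d))
    (M : ℕ → Set (Measure (Euc d))) (P : ℕ → B2 T d → Euc d) (F : ℕ → Euc d → B2 T d → ℝ)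
    (α : ℕ → Euc d → Euc d) : ℕ → Euc d → Euc d :=
  policy T M (fun t => P t (belief T mbar ν α)) (fun t x => F t x (belief T mbar ν α))

lemma continuousOn_bestResponse (hC : 0 < C) (hA : 0 ≤ A) (hm : SndMoment C mbar)
    (hν : ∀ t < T, SndMoment C (ν t)) (hne : ∀ t < T, (M t).Nonempty)
    (hM : ∀ t < T, ∀ ξ ∈ M t, SndMoment C ξ)
    (hbdd : ∀ b, MemB2 b → CtrlBdd C T (fun t => P t b) (fun t x => F t x b))
    (hF : ∀ t ≤ T, ∀ b₁ b₂ : B2 T d, MemB2 b₁ → MemB2 b₂ →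
      ∀ x, |F t x b₁ - F t x b₂| ≤ C * d1B b₁ b₂ * (1 + ‖x‖ ^ 2))
    (hP : ∀ t < T, ∀ b₁ b₂ : B2 T d, MemB2 b₁ → MemB2 b₂ →
      ‖P t b₁ - P t b₂‖ ≤ C * d1B b₁ b₂) :
    ContinuousOn (bestResponse T mbar ν M P F) (ctrlSet d A) := by
  refine continuousOn_pi.2 fun t => continuousOn_pi.2 fun x α hα => ?_
  by_cases ht : t < T
  swap
  · simp only [bestResponse, policy, ht, if_false]
    exact continuousWithinAt_const
  refine Metric.tendsto_nhds.2 fun ε hε => ?_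
  have hs := valueStab_pos hC (T - (t + 1))
  have hS : 0 < policyStab C T t := by unfold policyStab stabConst; positivity
  set S : ℝ := policyStab C T t * (1 + ‖x‖ ^ 2) with hSdef
  have hS' : 0 < S := by positivity
  set e : ℝ := ε ^ 2 / (2 * C * S) with he
  have he0 : 0 < e := by positivity
  filter_upwards [eventually_d1B_belief_le hC hA hm hν hα he0, self_mem_nhdsWithin]
    with α' h1 hα'
  have hb := memB2_belief hC hm hν hα
  have hb' := memB2_belief hC hm hν hα'
  have hd := mul_le_mul_of_nonneg_left h1 hC.le
  have key := norm_policy_sub_sq_le hC hne hM (hbdd _ hb') (hbdd _ hb) (ε := C * e)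
    (by positivity) ⟨fun t ht => (hP t ht _ _ hb' hb).trans hd, fun t ht x =>
      (hF t ht _ _ hb' hb x).trans (mul_le_mul_of_nonneg_right hd (by positivity))⟩ ht x
  have h2 : C * e * policyStab C T t * (1 + ‖x‖ ^ 2) = ε ^ 2 / 2 := by
    rw [mul_assoc, ← hSdef, he]
    field_simp
  rw [dist_comm, dist_eq_norm]
  refine lt_of_pow_lt_pow_left₀ 2 hε.le (key.trans_lt ?_)
  rw [h2]
  exact half_lt_self (by positivity)

end Equilibrium

/-- Existence of a solution `(u, α, m, μ, b)` to the risk-averse mean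
field game system (MFG): the dynamic programming equation (i) with terminal condition,
the optimal feedback (ii), the Kolmogorov equation (iii), the joint state-control
distribution (iv) and the consistency of the belief (v), together with the uniform
bounds given by constants `C_u, C_α, C_b` depending only on `C` and `T`. -/
theorem mfg_exists (T : ℕ) (C : ℝ) (hT : 0 < T) (hC : 0 < C) :
    ∃ Cu Cα Cb : ℝ, 0 < Cu ∧ 0 < Cα ∧ 0 < Cb ∧
      ∀ (d : ℕ) (mbar : Measure (Euc d)) (ν : ℕ → Measure (Euc d))
        (M : ℕ → Set (Measure (Euc d)))
        (F : ℕ → Euc d → B2 T d → ℝ) (P : ℕ → B2 T d → Euc d),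
        IsProbabilityMeasure mbar →
        (∫⁻ x, (‖x‖₊ : ℝ≥0∞) ^ (2 : ℕ) ∂mbar ≤ ENNReal.ofReal C) →
        (∀ t < T, IsProbabilityMeasure (ν t) ∧
          ∫⁻ x, (‖x‖₊ : ℝ≥0∞) ^ (2 : ℕ) ∂(ν t) ≤ ENNReal.ofReal C) →
        (∀ t < T, (M t).Nonempty) →
        (∀ t < T, ∀ ξ ∈ M t, IsProbabilityMeasure ξ ∧
          ∫⁻ y, (‖y‖₊ : ℝ≥0∞) ^ (2 : ℕ) ∂ξ ≤ ENNReal.ofReal C) →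
        (∀ t ≤ T, ∀ b : B2 T d, MemB2 b → ConvexOn ℝ Set.univ (fun x => F t x b) ∧
          ∀ x, -C ≤ F t x b ∧ F t x b ≤ C * (1 + ‖x‖ ^ 2)) →
        (∀ t ≤ T, ∀ b₁ b₂ : B2 T d, MemB2 b₁ → MemB2 b₂ →
          ∀ x, |F t x b₁ - F t x b₂| ≤ C * d1B b₁ b₂ * (1 + ‖x‖ ^ 2)) →
        (∀ t < T, ∀ b₁ b₂ : B2 T d, MemB2 b₁ → MemB2 b₂ →
          ‖P t b₁ - P t b₂‖ ≤ C * d1B b₁ b₂) →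
        (∀ t < T, ∀ b : B2 T d, MemB2 b → ‖P t b‖ ≤ C) →
        ∃ (u : ℕ → Euc d → ℝ) (α : ℕ → Euc d → Euc d)
          (m : ℕ → Measure (Euc d)) (μ : ℕ → Measure (Euc2 d)) (b : B2 T d),
          -- regularity and bounds
          (∀ t ≤ T, ConvexOn ℝ Set.univ (u t) ∧
            ∀ x, -Cu ≤ u t x ∧ u t x ≤ Cu * (1 + ‖x‖ ^ 2)) ∧
          (∀ t < T, LipschitzWith 1 (α t) ∧ ∀ x, ‖α t x‖ ≤ Cα * (1 + ‖x‖)) ∧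
          (∀ t ≤ T, IsProbabilityMeasure (m t) ∧
            ∫⁻ x, (‖x‖₊ : ℝ≥0∞) ^ (2 : ℕ) ∂(m t) ≤ ENNReal.ofReal Cb) ∧
          (∀ t < T, IsProbabilityMeasure (μ t) ∧
            ∫⁻ z, (‖z‖₊ : ℝ≥0∞) ^ (2 : ℕ) ∂(μ t) ≤ ENNReal.ofReal Cb) ∧
          MemB2 b ∧
          -- (i) dynamic programming equation
          (∀ x, u T x = F T x b) ∧
          (∀ t < T, ∀ x, u t x =
            ⨅ a : Euc d, mfgCost (M t) (P t b) (F t x b) (u (t + 1)) x a) ∧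
          -- (ii) α t x is the unique minimizer of the cost
          (∀ t < T, ∀ x,
            (∀ a, mfgCost (M t) (P t b) (F t x b) (u (t + 1)) x (α t x) ≤
              mfgCost (M t) (P t b) (F t x b) (u (t + 1)) x a) ∧
            (∀ a, (∀ a', mfgCost (M t) (P t b) (F t x b) (u (t + 1)) x a ≤
              mfgCost (M t) (P t b) (F t x b) (u (t + 1)) x a') → a = α t x)) ∧
          -- (iii) Kolmogorov equation
          m 0 = mbar ∧
          (∀ t < T, m (t + 1) = mconv (ν t) ((m t).map (fun x => x + α t x))) ∧
          -- (iv) joint distribution of states and controls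
          (∀ t < T, μ t = (m t).map (pairMap (α t))) ∧
          -- (v) the belief
          (∀ t : Fin T, b.1 t = μ t) ∧ b.2 = m T := by
  set A := policyConst C T with hAdef
  have hA : 0 < A := policyConst_pos hC T
  have hJ : 0 < jointConst C A T := by
    have := flowConst_pos (A := A) hC T
    unfold jointConst
    positivity
  refine ⟨valueConst C T, A, flowConst C A T + jointConst C A T, valueConst_pos hC T, hA,
    add_pos (flowConst_pos hC T) hJ, ?_⟩
  intro d mbar ν M F P hm0 hm1 hν hne hM hF hFlip hPlip hP
  have hm : SndMoment C mbar := ⟨hm0, hm1⟩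
  have hbdd : ∀ b, MemB2 b → CtrlBdd C T (fun t => P t b) (fun t x => F t x b) := fun b hb =>
    ⟨fun t ht => hP t ht b hb, fun t ht => hF t ht b hb⟩
  obtain ⟨α, hα, hfix⟩ := (isCompact_ctrlSet A).exists_fixedPoint_of_convex
    (convex_ctrlSet (d := d) A) ⟨0, zero_mem_ctrlSet hA.le⟩
    (continuousOn_bestResponse hC hA.le hm hν hne hM hbdd hFlip hPlip) fun α hα t =>
      have h := hbdd _ (memB2_belief hC hm hν hα)
      ⟨lipschitzWith_policy hC hne hM h t, norm_policy_le hC hne hM h t⟩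
  have hb := memB2_belief hC hm hν hα
  have h := hbdd _ hb
  have hmin : ∀ t < T, ∀ x a, mfgCost _ _ _ _ _ (α t x) ≤ mfgCost _ _ _ _ _ a :=
    fun t ht x a => by
      have := policy_isMin hC hne hM h ht x a
      rwa [← bestResponse, hfix] at this
  refine ⟨valueFn T M (fun t => P t (belief T mbar ν α)) (fun t x => F t x (belief T mbar ν α)),
    α, flow mbar ν α, fun t => (flow mbar ν α t).map (pairMap (α t)), belief T mbar ν α,
    fun t _ => quadBdd_valueFn hC hne hM h t, fun t _ => hα t,
    fun t ht => (sndMoment_flow hC hm hν hα t ht).mono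
      ((monotone_flowConst hC ht).trans (le_add_of_nonneg_right hJ.le)),
    fun t ht => (sndMoment_joint hC hm hν hα t ht.le).mono
      (le_add_of_nonneg_left (flowConst_pos hC T).le), hb,
    fun x => congrFun (valueFn_terminal T M _ _) x, fun t ht x => valueFn_of_lt ht M _ _ x,
    fun t ht x => ⟨hmin t ht x, fun a ha =>
      eq_of_quadCost_isMin (quadBdd_risk_valueFn hC hne hM h ht).1 (hmin t ht x) ha⟩,
    rfl, fun t _ => rfl, fun t _ => rfl, fun t => rfl, rfl⟩
end
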